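/- Each operator L_g (g ∈ ℳ) maps H¹ into itself with finite operator norm ‖L_g‖ := sup { ‖L_g φ‖_{H¹} : φ ∈ H¹, ‖φ‖_{H¹} ≤ 1 }, and the series Σ_{g∈ℳ} ‖L_g‖ converges. Consequently Σ_ℳ defines a bounded operator on H¹, and for every ε > 0 there exists C > 0 such that ‖T^k φ‖_{H¹} ≤ C·((√5 − 1)/2 + ε)^k·‖φ‖_{H¹} for every integer k ≥ 0 and every φ ∈ H¹; in particular the spectral radius of T on H¹ is at most (√5 − 1)/2. -/

import Mathlib

open Complex Filter Set Topology
open scoped ENNReal NNReal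

noncomputable section

/-- The complement in `ℂ` of the real segment `[a, b]`. -/
def cutPlane (a b : ℝ) : Set ℂ := (Complex.ofReal '' Set.Icc a b)ᶜ

/-- `𝒪¹(ℂ̄ ∖ [a,b])`: holomorphic on `ℂ ∖ [a,b]`, vanishing at infinity. -/
def O1 (a b : ℝ) : Set (ℂ → ℂ) :=
  {φ | DifferentiableOn ℂ φ (cutPlane a b) ∧
       Tendsto φ (Bornology.cobounded ℂ) (nhds 0)}

/-- `𝒪³(ℂ̄ ∖ [a,b])`: holomorphic on `ℂ ∖ [a,b]`, with `z²ψ(z) → 0` at infinity. -/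
def O3 (a b : ℝ) : Set (ℂ → ℂ) :=
  {ψ | DifferentiableOn ℂ ψ (cutPlane a b) ∧
       Tendsto (fun z => z ^ 2 * ψ z) (Bornology.cobounded ℂ) (nhds 0)}

/-- The `m`-th term (for the integer `m+1 ≥ 1`) of the series defining `T`. -/
def Tterm (φ : ℂ → ℂ) (m : ℕ) (z : ℂ) : ℂ :=
  -z * (φ (z⁻¹ - ((m : ℂ) + 1)) - φ (-((m : ℂ) + 1))) + deriv φ (-((m : ℂ) + 1))

/-- The operator `T`. -/
def Tbrj (φ : ℂ → ℂ) : ℂ → ℂ := fun z => ∑' m : ℕ, Tterm φ m z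

/-- The operator `T⁽³⁾`. -/
def T3brj (ψ : ℂ → ℂ) : ℂ → ℂ := fun z => -∑' m : ℕ, (z⁻¹) ^ 3 * ψ (z⁻¹ - ((m : ℂ) + 1))

/-- `g(m) = (0 1; 1 m)`. -/
def gmat (m : ℤ) : Matrix (Fin 2) (Fin 2) ℤ := !![0, 1; 1, m]

/-- The monoid `ℳ`. -/
def Mmon : Set (Matrix (Fin 2) (Fin 2) ℤ) :=
  {g | g = 1 ∨
    ((g 0 0 * g 1 1 - g 0 1 * g 1 0 = 1 ∨ g 0 0 * g 1 1 - g 0 1 * g 1 0 = -1) ∧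
      g 0 1 ≤ g 1 1 ∧ g 0 0 ≤ g 0 1 ∧ 0 ≤ g 0 0 ∧ g 1 0 ≤ g 1 1 ∧ g 0 0 ≤ g 1 0)}

/-- The operator `L_g` on `𝒪¹(ℂ̄ ∖ [0,1])`, for `g = (a b; c d) ∈ ℳ`. -/
def Lop (g : Matrix (Fin 2) (Fin 2) ℤ) (φ : ℂ → ℂ) : ℂ → ℂ := fun z =>
  if g = 1 then φ z
  else
    ((g 0 0 : ℂ) - (g 1 0 : ℂ) * z) *
        (φ (((g 1 1 : ℂ) * z - (g 0 1 : ℂ)) / ((g 0 0 : ℂ) - (g 1 0 : ℂ) * z)) -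
          φ (-(g 1 1 : ℂ) / (g 1 0 : ℂ))) -
      ((g 0 0 * g 1 1 - g 0 1 * g 1 0 : ℤ) : ℂ) * ((g 1 0 : ℂ))⁻¹ *
        deriv φ (-(g 1 1 : ℂ) / (g 1 0 : ℂ))

/-- `Σ_ℳ φ`, the sum of the family `(L_g φ)_{g ∈ ℳ}`. -/
def sumM (φ : ℂ → ℂ) : ℂ → ℂ := fun z => ∑' g : Mmon, Lop g.1 φ z

/-- The domain `D`. -/
def Dset : Set ℂ :=
  {z | ‖z‖ ≤ 1 ∧ 1 ≤ ‖z - Complex.I‖ ∧ 1 ≤ ‖z + Complex.I‖ ∧ 0 < z.re}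

/-- The domain `D₀`. -/
def D0set : Set ℂ := {z | ‖z + 1‖ ≤ 1 ∧ Real.sqrt 3 / 2 - 1 ≤ z.re}

/-- The domain `D₁`. -/
def D1set : Set ℂ :=
  {z | 1 ≤ ‖z‖ ∧ ‖z - (1 / Real.sqrt 3 : ℝ)‖ ≤ 1 / Real.sqrt 3}

/-- The domain `H₀`. -/
def H0set : Set ℂ := {z | ‖z - Complex.I‖ ≤ 1 ∧ 1 ≤ ‖z + 1‖ ∧ z.im ≤ 1 / 2}

/-- The domain `H₀′`. -/
def H0set' : Set ℂ := {z | (starRingEnd ℂ) z ∈ H0set}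

/-- The domain `Δ`. -/
def Δset : Set ℂ := {z | ‖z‖ ≤ 1 ∧ 1 ≤ ‖z + 1‖ ∧ |z.im| ≤ 1 / 2}

/-- The domain `D∞`. -/
def Dinf : Set ℂ :=
  {z | 1 / 2 < |z.im|} ∪ {z | z.re < Real.sqrt 3 / 2 - 1} ∪
    {z | Real.sqrt 3 / 2 < z.re ∧ 1 / Real.sqrt 3 < ‖z - (1 / Real.sqrt 3 : ℝ)‖}

end

noncomputable section

/-- Transfer of `φ ∈ 𝒪¹(ℂ̄∖[0,1])` to the unit disc via `w ↦ (w+1)²/(4w)`. -/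
def Fdisc (φ : ℂ → ℂ) : ℂ → ℂ := fun w =>
  if w = 0 then 0 else φ ((w + 1) ^ 2 / (4 * w))

/-- The `H¹` norm of `φ ∈ 𝒪¹(ℂ̄∖[0,1])`. -/
def Hnorm (φ : ℂ → ℂ) : ℝ≥0∞ :=
  ⨆ r : Set.Ioo (0 : ℝ) 1,
    ENNReal.ofReal
      ((2 * Real.pi)⁻¹ *
        ∫ θ in (0 : ℝ)..(2 * Real.pi),
          ‖Fdisc φ ((r : ℝ) * Complex.exp (θ * Complex.I))‖)

/-- The space `H¹`. -/
def H1space : Set (ℂ → ℂ) := {φ | φ ∈ O1 0 1 ∧ Hnorm φ < ⊤}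

/-- The operator norm of `L_g` on `H¹`. -/
def Lnorm (g : Matrix (Fin 2) (Fin 2) ℤ) : ℝ≥0∞ :=
  ⨆ φ : {φ : ℂ → ℂ // φ ∈ H1space ∧ Hnorm φ ≤ 1}, Hnorm (Lop g φ.1)

lemma poissonKernel_zero_nonneg {w z : ℂ} (h : ‖w‖ ≤ ‖z‖) : 0 ≤ poissonKernel 0 w z := by
  rw [poissonKernel_def]
  simp only [sub_zero]
  have : ‖w‖ ^ 2 ≤ ‖z‖ ^ 2 := by gcongr
  apply div_nonneg (by linarith) (by positivity)

lemma continuousOn_poissonKernel_zero {w : ℂ} {r : ℝ} (h : ‖w‖ < r) :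
    ContinuousOn (poissonKernel 0 w) (Metric.sphere 0 |r|) := by
  rw [poissonKernel_eq_re_herglotzRieszKernel]
  exact continuous_re.comp_continuousOn
    (continuousOn_herglotzRieszKernel_sphere (by simpa using h))

lemma norm_le_circleAverage_poissonKernel {F : ℂ → ℂ} {R : ℝ} {w : ℂ}
    (hF : DiffContOnCl ℂ F (Metric.ball 0 R)) (hw : ‖w‖ < R) :
    ‖F w‖ ≤ Real.circleAverage (fun ζ => poissonKernel 0 w ζ * ‖F ζ‖) 0 R := by
  have hR : 0 < R := (norm_nonneg w).trans_lt hw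
  rw [← hF.circleAverage_poissonKernel_smul (w := w) (by simpa using hw)]
  simp only [Real.circleAverage_def]
  rw [norm_smul, smul_eq_mul, Real.norm_of_nonneg (by positivity)]
  gcongr
  refine (intervalIntegral.norm_integral_le_integral_norm (by positivity)).trans (le_of_eq ?_)
  congr 1
  ext θ
  rw [Pi.smul_apply', norm_smul, Real.norm_of_nonneg]
  exact poissonKernel_zero_nonneg (by simp [abs_of_pos hR, hw.le])

/-- Littlewood subordination, weighted by a Poisson kernel, with both radii fixed. -/
theorem circleAverage_poissonKernel_mul_norm_comp_le_circleAverage {F Φ : ℂ → ℂ} {p : ℂ} {r R : ℝ}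
    (hF : DiffContOnCl ℂ F (Metric.ball 0 R)) (hΦ : DifferentiableOn ℂ Φ (Metric.closedBall 0 r))
    (hm : MapsTo Φ (Metric.closedBall 0 r) (Metric.ball 0 R)) (hp : ‖p‖ < r) :
    Real.circleAverage (fun ζ => poissonKernel 0 p ζ * ‖F (Φ ζ)‖) 0 r ≤
      Real.circleAverage (fun ζ => poissonKernel 0 (Φ p) ζ * ‖F ζ‖) 0 R := by
  have hr0 : 0 < r := (norm_nonneg p).trans_lt hp
  have hmaps : ∀ ζ ∈ Metric.closedBall (0 : ℂ) r, ‖Φ ζ‖ < R := fun ζ hζ => by simpa using hm hζ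
  have hRpos : 0 < R := (norm_nonneg _).trans_lt (hmaps 0 (by simpa using hr0.le))
  have hsph : ∀ {s : ℝ}, 0 < s → Metric.sphere (0 : ℂ) |s| ⊆ Metric.closedBall 0 s := by
    intro s hs; rw [abs_of_pos hs]; exact Metric.sphere_subset_closedBall
  have hFc : ContinuousOn (fun ζ => ‖F ζ‖) (Metric.sphere 0 |R|) :=
    (hF.continuousOn_ball.mono (hsph hRpos)).norm
  have hFi : CircleIntegrable (fun ζ => ‖F ζ‖) 0 R := hFc.circleIntegrable'
  have hFi' : CircleIntegrable (fun ζ => ((‖F ζ‖ : ℝ) : ℂ)) 0 R :=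
    (continuous_ofReal.comp_continuousOn hFc).circleIntegrable'
  set H : ℂ → ℂ := fun w =>
    Real.circleAverage (fun ζ => herglotzRieszKernel 0 w ζ • ((‖F ζ‖ : ℝ) : ℂ)) 0 R with hH
  have hHd : DifferentiableOn ℂ H (Metric.ball 0 R) :=
    differentiableOn_circleAverage_herglotzRieszKernel_smul hFi'
  have hHre : ∀ w, ‖w‖ < R → (H w).re =
      Real.circleAverage (fun ζ => poissonKernel 0 w ζ * ‖F ζ‖) 0 R := by
    intro w hw
    rw [hH]
    simp only
    rw [re_circleAverage_herglotzRieszKernel_smul hFi (by simpa using hw),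
      ← poissonKernel_eq_re_herglotzRieszKernel]
    rfl
  have hHΦ : DifferentiableOn ℂ (H ∘ Φ) (Metric.closedBall 0 r) := hHd.comp hΦ hm
  have hHΦ' : DiffContOnCl ℂ (H ∘ Φ) (Metric.ball 0 r) := by
    refine DifferentiableOn.diffContOnCl (hHΦ.mono ?_)
    rw [closure_ball _ hr0.ne']
  have hPc := continuousOn_poissonKernel_zero hp
  have hI1 : CircleIntegrable (fun ζ => poissonKernel 0 p ζ * ‖F (Φ ζ)‖) 0 r :=
    (hPc.mul ((hF.continuousOn_ball.comp (hΦ.continuousOn.mono (hsph hr0))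
      fun ζ hζ => Metric.ball_subset_closedBall (hm (hsph hr0 hζ))).norm)).circleIntegrable'
  have hHc : ContinuousOn (H ∘ Φ) (Metric.sphere 0 |r|) := hHΦ.continuousOn.mono (hsph hr0)
  have hI2 : CircleIntegrable (fun ζ => poissonKernel 0 p ζ * (H (Φ ζ)).re) 0 r :=
    (hPc.mul (continuous_re.comp_continuousOn hHc)).circleIntegrable'
  have hI3 : CircleIntegrable (poissonKernel 0 p • (H ∘ Φ)) 0 r :=
    (hPc.smul hHc).circleIntegrable'
  calc _ ≤ Real.circleAverage (fun ζ => poissonKernel 0 p ζ * (H (Φ ζ)).re) 0 r := by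
        refine Real.circleAverage_mono hI1 hI2 fun ζ hζ => ?_
        have hζn : ‖ζ‖ = r := by simpa [abs_of_pos hr0] using hζ
        refine mul_le_mul_of_nonneg_left ?_ (poissonKernel_zero_nonneg (by rw [hζn]; exact hp.le))
        rw [hHre _ (hmaps ζ (hsph hr0 hζ))]
        exact norm_le_circleAverage_poissonKernel hF (hmaps ζ (hsph hr0 hζ))
    _ = (Real.circleAverage (poissonKernel 0 p • (H ∘ Φ)) 0 r).re := by
        rw [← reCLM_apply, ← reCLM.circleAverage_comp_comm hI3]
        congr 1
        ext ζ
        simp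
    _ = (H (Φ p)).re := by
        rw [hHΦ'.circleAverage_poissonKernel_smul (by simpa using hp)]; rfl
    _ = _ := hHre _ (hmaps p (by simpa using hp.le))

lemma circleAverage_poissonKernel_mul_norm_le {F : ℂ → ℂ} {R : ℝ} {q : ℂ} (hq : ‖q‖ < R)
    (hFc : ContinuousOn (fun ζ => ‖F ζ‖) (Metric.sphere 0 |R|)) :
    Real.circleAverage (fun ζ => poissonKernel 0 q ζ * ‖F ζ‖) 0 R ≤
      (R + ‖q‖) / (R - ‖q‖) * Real.circleAverage (fun ζ => ‖F ζ‖) 0 R := by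
  have hRpos : 0 < R := (norm_nonneg q).trans_lt hq
  calc _ ≤ Real.circleAverage (fun ζ => (R + ‖q‖) / (R - ‖q‖) * ‖F ζ‖) 0 R := by
        refine Real.circleAverage_mono
          ((continuousOn_poissonKernel_zero hq).mul hFc).circleIntegrable'
          (continuousOn_const.mul hFc).circleIntegrable' fun ζ hζ => ?_
        refine mul_le_mul_of_nonneg_right ?_ (norm_nonneg _)
        rw [poissonKernel_eq_re_herglotzRieszKernel]
        have := re_herglotzRieszKernel_le (c := 0) (z := ζ) (w := q) (R := R)
          (by simpa [abs_of_pos hRpos] using hζ) (by simpa using hq)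
        simpa [herglotzRieszKernel_def] using this
    _ = _ := by
        simpa [smul_eq_mul] using Real.circleAverage_fun_smul (𝕜 := ℝ)
          (a := (R + ‖q‖) / (R - ‖q‖)) (f := fun ζ => ‖F ζ‖) (c := 0) (R := R)

lemma tendsto_harnack (q N : ℝ) (hq : q < 1) :
    Tendsto (fun R : ℝ => (R + q) / (R - q) * N) (𝓝[<] 1) (𝓝 ((1 + q) / (1 - q) * N)) := by
  have : ContinuousAt (fun R : ℝ => (R + q) / (R - q) * N) 1 := by
    refine ContinuousAt.mul (ContinuousAt.div (by fun_prop) (by fun_prop) (by linarith)) (by fun_prop)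
  exact this.tendsto.mono_left nhdsWithin_le_nhds

lemma diffContOnCl_ball_of_lt_one {F : ℂ → ℂ} (hF : DifferentiableOn ℂ F (Metric.ball 0 1)) {R : ℝ}
    (hR : R < 1) : DiffContOnCl ℂ F (Metric.ball 0 R) :=
  hF.diffContOnCl_ball (Metric.closedBall_subset_ball hR)

lemma continuousOn_norm_sphere {F : ℂ → ℂ} (hF : DifferentiableOn ℂ F (Metric.ball 0 1)) {R : ℝ}
    (hR0 : 0 < R) (hR : R < 1) : ContinuousOn (fun ζ => ‖F ζ‖) (Metric.sphere 0 |R|) := by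
  refine (hF.continuousOn.mono ?_).norm
  rw [abs_of_pos hR0]
  exact Metric.sphere_subset_closedBall.trans (Metric.closedBall_subset_ball hR)

/-- Littlewood subordination, weighted by a Poisson kernel. -/
theorem circleAverage_poissonKernel_mul_norm_comp_le {F Φ : ℂ → ℂ} {N : ℝ}
    (hF : DifferentiableOn ℂ F (Metric.ball 0 1))
    (hN : ∀ R ∈ Ioo (0 : ℝ) 1, Real.circleAverage (fun ζ => ‖F ζ‖) 0 R ≤ N)
    (hΦ : DifferentiableOn ℂ Φ (Metric.ball 0 1))
    (hm : MapsTo Φ (Metric.ball 0 1) (Metric.ball 0 1)) {p : ℂ} {r : ℝ}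
    (hp : ‖p‖ < r) (hr : r < 1) :
    Real.circleAverage (fun ζ => poissonKernel 0 p ζ * ‖F (Φ ζ)‖) 0 r ≤
      (1 + ‖Φ p‖) / (1 - ‖Φ p‖) * N := by
  have hr0 : 0 < r := (norm_nonneg p).trans_lt hp
  have hsub : Metric.closedBall (0 : ℂ) r ⊆ Metric.ball 0 1 := Metric.closedBall_subset_ball hr
  have hc : ContinuousOn (fun ζ => ‖Φ ζ‖) (Metric.closedBall 0 r) :=
    (hΦ.continuousOn.mono hsub).norm
  obtain ⟨ζ₀, hζ₀, hmax⟩ := (isCompact_closedBall (0 : ℂ) r).exists_isMaxOn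
    ⟨0, by simp [hr0.le]⟩ hc
  have hR0 : ‖Φ ζ₀‖ < 1 := by simpa using hm (hsub hζ₀)
  have hpΦ : ‖Φ p‖ < 1 := by
    simpa using hm (show p ∈ Metric.ball (0 : ℂ) 1 by simpa using hp.trans hr)
  refine ge_of_tendsto (tendsto_harnack _ N hpΦ) ?_
  filter_upwards [Ioo_mem_nhdsLT hR0] with R ⟨hR1, hR2⟩
  have hRpos : 0 < R := (norm_nonneg _).trans_lt hR1
  have hmaps : ∀ ζ ∈ Metric.closedBall (0 : ℂ) r, ‖Φ ζ‖ < R := fun ζ hζ => (hmax hζ).trans_lt hR1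
  have hpR := hmaps p (by simpa using hp.le)
  refine (circleAverage_poissonKernel_mul_norm_comp_le_circleAverage
    (diffContOnCl_ball_of_lt_one hF hR2) (hΦ.mono hsub)
    (fun ζ hζ => by simpa using hmaps ζ hζ) hp).trans ?_
  refine (circleAverage_poissonKernel_mul_norm_le hpR (continuousOn_norm_sphere hF hRpos hR2)).trans ?_
  refine mul_le_mul_of_nonneg_left (hN R ⟨hRpos, hR2⟩) ?_
  exact div_nonneg (by positivity) (by linarith)

lemma circleAverage_norm_mono {F : ℂ → ℂ} {r s : ℝ}
    (hF : DifferentiableOn ℂ F (Metric.ball 0 1)) (hr : 0 < r) (hrs : r < s) (hs : s < 1) :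
    Real.circleAverage (fun ζ => ‖F ζ‖) 0 r ≤ Real.circleAverage (fun ζ => ‖F ζ‖) 0 s := by
  have h1 : ∀ t : ℝ, 0 < t → ∀ ζ ∈ Metric.sphere (0 : ℂ) |t|, poissonKernel 0 0 ζ = 1 := by
    intro t ht ζ hζ
    have : ‖ζ‖ = t := by simpa [abs_of_pos ht] using hζ
    have h0 : ζ ≠ 0 := by rw [← norm_pos_iff, this]; exact ht
    simp [poissonKernel_def, h0]
  have := circleAverage_poissonKernel_mul_norm_comp_le_circleAverage (Φ := id) (p := 0)
    (diffContOnCl_ball_of_lt_one hF hs) differentiableOn_id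
    (Metric.closedBall_subset_ball hrs) (by simpa using hr)
  rw [Real.circleAverage_congr_sphere (f₂ := fun ζ => ‖F ζ‖)
      (fun ζ hζ => by simp [h1 r hr ζ hζ]),
    Real.circleAverage_congr_sphere (f₁ := fun ζ => poissonKernel 0 (id 0) ζ * ‖F ζ‖)
      (f₂ := fun ζ => ‖F ζ‖)
      (fun ζ hζ => by simp [h1 s (hr.trans hrs) ζ hζ])] at this
  exact this

/-- Growth estimate in the disc for functions of bounded mean. -/
lemma norm_le_of_circleAverage_le {F : ℂ → ℂ} {N : ℝ}
    (hF : DifferentiableOn ℂ F (Metric.ball 0 1))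
    (hN : ∀ R ∈ Ioo (0 : ℝ) 1, Real.circleAverage (fun ζ => ‖F ζ‖) 0 R ≤ N) {q : ℂ} (hq : ‖q‖ < 1) :
    ‖F q‖ ≤ (1 + ‖q‖) / (1 - ‖q‖) * N := by
  refine ge_of_tendsto (tendsto_harnack _ N hq) ?_
  filter_upwards [Ioo_mem_nhdsLT hq] with R ⟨hR1, hR2⟩
  have hRpos : 0 < R := (norm_nonneg _).trans_lt hR1
  refine (norm_le_circleAverage_poissonKernel (diffContOnCl_ball_of_lt_one hF hR2) hR1).trans ?_
  refine (circleAverage_poissonKernel_mul_norm_le hR1 (continuousOn_norm_sphere hF hRpos hR2)).trans ?_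
  refine mul_le_mul_of_nonneg_left (hN R ⟨hRpos, hR2⟩) ?_
  exact div_nonneg (by positivity) (by linarith)

/-- The Poisson kernel has mean one. -/
lemma circleAverage_poissonKernel {p : ℂ} {r : ℝ} (hp : ‖p‖ < r) :
    Real.circleAverage (poissonKernel 0 p) 0 r = 1 := by
  have h := (diffContOnCl_const (𝕜 := ℂ) (s := Metric.ball (0 : ℂ) r) (c := (1 : ℂ))).circleAverage_poissonKernel_smul
    (w := p) (by simpa using hp)
  have hi : CircleIntegrable (poissonKernel 0 p • fun _ : ℂ => (1 : ℂ)) 0 r :=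
    ((continuousOn_poissonKernel_zero hp).smul continuousOn_const).circleIntegrable'
  have := reCLM.circleAverage_comp_comm hi
  rw [h] at this
  rw [← show reCLM 1 = 1 from one_re, ← this]
  congr 1
  ext ζ
  simp

/-- The conformal map from the punctured disc onto `ℂ ∖ [0,1]`. -/
def jouk (w : ℂ) : ℂ := (w + 1) ^ 2 / (4 * w)

lemma mem_cutPlane_iff {z : ℂ} : z ∈ cutPlane 0 1 ↔ ¬ (z.im = 0 ∧ 0 ≤ z.re ∧ z.re ≤ 1) := by
  rw [cutPlane, mem_compl_iff, not_iff_not]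
  constructor
  · rintro ⟨x, hx, rfl⟩; simpa using hx
  · rintro ⟨h1, h2, h3⟩; exact ⟨z.re, ⟨h2, h3⟩, Complex.ext (by simp) (by simp [h1])⟩

lemma isOpen_cutPlane : IsOpen (cutPlane 0 1) := by
  rw [cutPlane]
  exact (isCompact_Icc.image continuous_ofReal).isClosed.isOpen_compl

lemma one_lt_norm_add_norm_of_mem {z : ℂ} (hz : z ∈ cutPlane 0 1) : 1 < ‖z‖ + ‖z - 1‖ := by
  rw [mem_cutPlane_iff] at hz
  by_contra! h
  apply hz
  have h1 : |z.re| ≤ ‖z‖ := abs_re_le_norm z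
  have h2 : |z.re - 1| ≤ ‖z - 1‖ := by simpa using abs_re_le_norm (z - 1)
  have h3 := le_abs_self z.re
  have h4 := neg_le_abs (z.re - 1)
  have h5 := le_abs_self (z.re - 1)
  have h6 := neg_le_abs z.re
  refine ⟨?_, by linarith, by linarith⟩
  have h7 : |z.re| = ‖z‖ := by linarith
  exact abs_re_eq_norm.1 h7

lemma mem_cutPlane_of_one_lt {z : ℂ} (hz : 1 < ‖z‖ + ‖z - 1‖) : z ∈ cutPlane 0 1 := by
  rintro ⟨x, ⟨h0, h1⟩, rfl⟩
  rw [← ofReal_one, ← ofReal_sub, norm_real, norm_real, Real.norm_of_nonneg h0,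
    Real.norm_of_nonpos (by linarith)] at hz
  linarith

lemma norm_jouk_add {w : ℂ} (hw : w ≠ 0) :
    ‖jouk w‖ + ‖jouk w - 1‖ = (‖w‖ ^ 2 + 1) / (2 * ‖w‖) := by
  have h1 : jouk w - 1 = (w - 1) ^ 2 / (4 * w) := by rw [jouk]; field_simp; ring
  have hp : ‖w + 1‖ ^ 2 + ‖w - 1‖ ^ 2 = 2 * (‖w‖ ^ 2 + 1) := by
    have := parallelogram_law_with_norm ℝ w 1
    simp only [norm_one] at this
    nlinarith [this]
  have hw' : ‖w‖ ≠ 0 := by simpa using hw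
  rw [h1, jouk, norm_div, norm_div, norm_pow, norm_pow, norm_mul]
  simp only [RCLike.norm_ofNat]
  rw [← add_div, hp]
  field_simp
  ring

lemma jouk_mem_cutPlane {w : ℂ} (hw : w ≠ 0) (h1 : ‖w‖ < 1) : jouk w ∈ cutPlane 0 1 := by
  apply mem_cutPlane_of_one_lt
  have hw' : 0 < ‖w‖ := by simpa using hw
  rw [norm_jouk_add hw, lt_div_iff₀ (by positivity)]
  nlinarith

/-- The Cayley transform of the principal square root, from the slit plane to the disc. -/
def cayleySqrt (ρ : ℂ) : ℂ := (1 - ρ ^ (1 / 2 : ℂ)) / (1 + ρ ^ (1 / 2 : ℂ))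

lemma cpow_half_sq (ρ : ℂ) : (ρ ^ (1 / 2 : ℂ)) ^ 2 = ρ := by
  rw [one_div]
  exact_mod_cast cpow_nat_inv_pow ρ two_ne_zero

lemma cpow_half_re_pos {ρ : ℂ} (h : ρ ∈ slitPlane) : 0 < (ρ ^ (1 / 2 : ℂ)).re := by
  have h0 := slitPlane_ne_zero h
  rw [cpow_def_of_ne_zero h0, exp_re]
  refine mul_pos (Real.exp_pos _) (Real.cos_pos_of_mem_Ioo ?_)
  have h1 := neg_pi_lt_arg ρ
  have h2 := arg_le_pi ρ
  have h3 := (mem_slitPlane_iff_arg.1 h).1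
  have h4 : arg ρ < Real.pi := lt_of_le_of_ne h2 h3
  have : (Complex.log ρ * (1 / 2)).im = arg ρ / 2 := by
    simp [mul_im, log_im]; ring
  rw [this]
  constructor <;> linarith

lemma norm_cayleySqrt_lt {ρ : ℂ} (h : ρ ∈ slitPlane) : ‖cayleySqrt ρ‖ < 1 := by
  have hs := cpow_half_re_pos h
  rw [cayleySqrt]
  generalize ρ ^ (1 / 2 : ℂ) = s at hs
  have h1 : 0 < ‖1 + s‖ := by
    rw [norm_pos_iff]; intro h; have := congrArg re h; simp at this; linarith
  rw [norm_div, div_lt_one h1, ← sq_lt_sq₀ (norm_nonneg _) (norm_nonneg _),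
    ← normSq_eq_norm_sq, ← normSq_eq_norm_sq, normSq_apply, normSq_apply]
  simp
  nlinarith

lemma one_add_cpow_half_ne {ρ : ℂ} (h : ρ ∈ slitPlane) : 1 + ρ ^ (1 / 2 : ℂ) ≠ 0 := by
  intro h'
  have := congrArg re h'
  have hs := cpow_half_re_pos h
  simp only [add_re, one_re, zero_re] at this
  linarith

lemma jouk_cayleySqrt {ρ : ℂ} (h : ρ ∈ slitPlane) (h1 : ρ ≠ 1) :
    cayleySqrt ρ ≠ 0 ∧ jouk (cayleySqrt ρ) = 1 / (1 - ρ) := by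
  have hs := one_add_cpow_half_ne h
  have hsq := cpow_half_sq ρ
  rw [cayleySqrt]
  generalize ρ ^ (1 / 2 : ℂ) = s at *
  subst hsq
  have h2 : 1 - s ≠ 0 := by
    intro h'; apply h1; rw [← sub_eq_zero.1 h']; ring
  refine ⟨div_ne_zero h2 hs, ?_⟩
  have h3 : 1 - s ^ 2 ≠ 0 := by
    rw [show 1 - s ^ 2 = (1 - s) * (1 + s) by ring]; exact mul_ne_zero h2 hs
  rw [jouk]
  field_simp
  ring

lemma differentiableAt_cayleySqrt {ρ : ℂ} (h : ρ ∈ slitPlane) :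
    DifferentiableAt ℂ cayleySqrt ρ := by
  have h1 : DifferentiableAt ℂ (fun ρ : ℂ => ρ ^ (1 / 2 : ℂ)) ρ :=
    (hasStrictDerivAt_cpow_const h).hasDerivAt.differentiableAt
  exact ((differentiableAt_const 1).sub h1).div ((differentiableAt_const 1).add h1)
    (one_add_cpow_half_ne h)

lemma one_sub_inv_mem_slitPlane {w : ℂ} (hw : w ∈ cutPlane 0 1) : 1 - 1 / w ∈ slitPlane := by
  by_contra h
  rw [mem_slitPlane_iff] at h
  push Not at h
  obtain ⟨h1, h2⟩ := h
  have h3 : 1 - 1 / w = ((1 - 1 / w).re : ℂ) := Complex.ext (by simp) (by simpa using h2)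
  set t := (1 - 1 / w).re
  have h0 : w ≠ 0 := by
    rintro rfl; exact hw ⟨0, by simp, by simp⟩
  have h4 : w = ((1 / (1 - t) : ℝ) : ℂ) := by
    have : 1 / w = 1 - (t : ℂ) := by rw [← h3]; ring
    push_cast
    rw [← this]; simp
  apply hw
  refine ⟨1 / (1 - t), ⟨?_, ?_⟩, h4.symm⟩
  · apply div_nonneg <;> linarith
  · rw [div_le_one] <;> linarith

lemma ne_zero_of_mem_cutPlane {z : ℂ} (hz : z ∈ cutPlane 0 1) : z ≠ 0 := by
  rintro rfl; exact hz ⟨0, by simp, by simp⟩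

lemma exists_jouk_eq {z : ℂ} (hz : z ∈ cutPlane 0 1) : ∃ w, w ≠ 0 ∧ ‖w‖ < 1 ∧ jouk w = z := by
  have h0 := ne_zero_of_mem_cutPlane hz
  have h := one_sub_inv_mem_slitPlane hz
  have := jouk_cayleySqrt h (by simpa using h0)
  exact ⟨_, this.1, norm_cayleySqrt_lt h, by rw [this.2]; simp⟩

lemma Fdisc_of_ne {φ : ℂ → ℂ} {w : ℂ} (hw : w ≠ 0) : Fdisc φ w = φ (jouk w) := by
  simp [Fdisc, hw, jouk]

lemma tendsto_jouk_zero : Tendsto jouk (𝓝[≠] 0) (Bornology.cobounded ℂ) := by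
  have h1 : Tendsto (fun w : ℂ => w⁻¹) (𝓝[≠] 0) (Bornology.cobounded ℂ) :=
    tendsto_inv₀_nhdsNE_zero
  rw [← tendsto_norm_atTop_iff_cobounded] at h1 ⊢
  have h2 : Tendsto (fun w : ℂ => ‖(w + 1) ^ 2 / 4‖) (𝓝[≠] 0) (𝓝 (1 / 4)) := by
    have : ContinuousAt (fun w : ℂ => ‖(w + 1) ^ 2 / 4‖) 0 := by fun_prop
    have h := this.tendsto
    simp at h
    simpa using h.mono_left nhdsWithin_le_nhds
  refine (h1.atTop_mul_pos (by norm_num : (0 : ℝ) < 1 / 4) h2).congr fun w => ?_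
  rw [← norm_mul, jouk]
  congr 1
  by_cases hw : w = 0
  · simp [hw]
  · field_simp

lemma differentiableOn_Fdisc {φ : ℂ → ℂ} (h : φ ∈ O1 0 1) :
    DifferentiableOn ℂ (Fdisc φ) (Metric.ball 0 1) := by
  rw [← differentiableOn_compl_singleton_and_continuousAt_iff
    (Metric.ball_mem_nhds (0 : ℂ) one_pos)]
  constructor
  · have : DifferentiableOn ℂ (fun w => φ (jouk w)) (Metric.ball 0 1 \ {0}) := by
      refine h.1.comp (t := cutPlane 0 1) ?_ ?_
      · intro w hw
        have : w ≠ 0 := hw.2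
        unfold jouk
        exact (DifferentiableAt.div (by fun_prop) (by fun_prop) (by simpa using this)).differentiableWithinAt
      · intro w hw
        exact jouk_mem_cutPlane hw.2 (by simpa using hw.1)
    exact this.congr fun w hw => Fdisc_of_ne hw.2
  · rw [continuousAt_iff_punctured_nhds, show Fdisc φ 0 = 0 by simp [Fdisc]]
    refine (h.2.comp tendsto_jouk_zero).congr' ?_
    filter_upwards [self_mem_nhdsWithin] with w hw
    exact (Fdisc_of_ne hw).symm

lemma Hnorm_eq (φ : ℂ → ℂ) : Hnorm φ = ⨆ r : Ioo (0 : ℝ) 1,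
    ENNReal.ofReal (Real.circleAverage (fun ζ => ‖Fdisc φ ζ‖) 0 r) := by
  simp [Hnorm, Real.circleAverage_def, circleMap]

lemma circleAverage_le_toReal_Hnorm {φ : ℂ → ℂ} (h : φ ∈ H1space) :
    ∀ R ∈ Ioo (0 : ℝ) 1, Real.circleAverage (fun ζ => ‖Fdisc φ ζ‖) 0 R ≤ (Hnorm φ).toReal := by
  intro R hR
  rw [← ENNReal.ofReal_le_iff_le_toReal h.2.ne, Hnorm_eq]
  exact le_iSup (fun r : Ioo (0 : ℝ) 1 =>
    ENNReal.ofReal (Real.circleAverage (fun ζ => ‖Fdisc φ ζ‖) 0 r)) ⟨R, hR⟩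

lemma Hnorm_le_of_eventually {φ : ℂ → ℂ} (h : φ ∈ O1 0 1) {B r₀ : ℝ} (hr₀ : r₀ < 1)
    (hB : ∀ r ∈ Ioo r₀ 1, 0 < r → Real.circleAverage (fun ζ => ‖Fdisc φ ζ‖) 0 r ≤ B) :
    Hnorm φ ≤ ENNReal.ofReal B := by
  rw [Hnorm_eq]
  refine iSup_le fun ⟨r, hr0, hr1⟩ => ENNReal.ofReal_le_ofReal ?_
  have hm : max r r₀ < 1 := max_lt hr1 hr₀
  obtain ⟨s, hs1, hs2⟩ := exists_between hm
  have h1 : r < s := (le_max_left _ _).trans_lt hs1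
  exact (circleAverage_norm_mono (differentiableOn_Fdisc h) hr0 h1 hs2).trans
    (hB s ⟨(le_max_right _ _).trans_lt hs1, hs2⟩ (hr0.trans h1))

lemma norm_le_one_sub_of_le {w : ℂ} (h1 : ‖w‖ < 1) (h0 : w ≠ 0) {s t : ℝ}
    (ht : t ≤ 1 / 2) (hts : t ^ 2 ≤ s - 1) (hs : s ≤ ‖jouk w‖ + ‖jouk w - 1‖) :
    ‖w‖ ≤ 1 - t := by
  have hw' : 0 < ‖w‖ := by simpa using h0
  rw [norm_jouk_add h0, le_div_iff₀ (by positivity)] at hs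
  by_contra! h
  have h2 : 1 - ‖w‖ < t := by linarith
  have h3 : (1 - ‖w‖) ^ 2 < t ^ 2 := by
    apply pow_lt_pow_left₀ h2 (by linarith) (by norm_num)
  nlinarith

/-- Growth estimate off the segment. -/
lemma norm_le_Hnorm {φ : ℂ → ℂ} (h : φ ∈ H1space) {s t : ℝ} (ht0 : 0 < t) (ht : t ≤ 1 / 2)
    (hts : t ^ 2 ≤ s - 1) {z : ℂ} (hs : s ≤ ‖z‖ + ‖z - 1‖) :
    ‖φ z‖ ≤ 2 / t * (Hnorm φ).toReal := by
  have hz : z ∈ cutPlane 0 1 := mem_cutPlane_of_one_lt (by nlinarith)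
  obtain ⟨w, hw0, hw1, rfl⟩ := exists_jouk_eq hz
  have hw := norm_le_one_sub_of_le hw1 hw0 ht hts hs
  rw [← Fdisc_of_ne (φ := φ) hw0]
  refine (norm_le_of_circleAverage_le (differentiableOn_Fdisc h.1)
    (circleAverage_le_toReal_Hnorm h) hw1).trans ?_
  gcongr
  · linarith
  · linarith

lemma three_halves_le_of_far {w : ℂ} (h : 3 / 4 ≤ ‖w - 1 / 2‖) : 3 / 2 ≤ ‖w‖ + ‖w - 1‖ := by
  have hp : ‖w‖ ^ 2 + ‖w - 1‖ ^ 2 = 2 * (‖w - 1 / 2‖ ^ 2 + 1 / 4) := by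
    have := parallelogram_law_with_norm ℝ (w - 1 / 2) (1 / 2)
    rw [show w - 1 / 2 + 1 / 2 = w by ring, show w - 1 / 2 - 1 / 2 = w - 1 by ring] at this
    norm_num at this
    norm_num
    linarith
  have hq : ‖w - 1 / 2‖ ^ 2 - 1 / 4 ≤ ‖w‖ * ‖w - 1‖ := by
    rw [← norm_mul, show w * (w - 1) = (w - 1 / 2) ^ 2 - 1 / 4 by ring]
    refine le_trans ?_ (norm_sub_norm_le _ _)
    rw [norm_pow]; norm_num
  nlinarith [norm_nonneg w, norm_nonneg (w - 1), norm_nonneg (w - 1 / 2)]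

lemma mem_cutPlane_of_far {w : ℂ} (h : 3 / 4 ≤ ‖w - 1 / 2‖) : w ∈ cutPlane 0 1 :=
  mem_cutPlane_of_one_lt (by linarith [three_halves_le_of_far h])

lemma norm_le_Hnorm_of_far {φ : ℂ → ℂ} (h : φ ∈ H1space) {w : ℂ} (hw : 3 / 4 ≤ ‖w - 1 / 2‖) :
    ‖φ w‖ ≤ 4 * (Hnorm φ).toReal := by
  have := norm_le_Hnorm h (s := 3 / 2) (t := 1 / 2) (by norm_num) (by norm_num) (by norm_num)
    (three_halves_le_of_far hw)
  norm_num at this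
  exact this

/-- The transfer of `φ` to the coordinate `v = 1 / (w - 1/2)` at infinity. -/
def atInfty (φ : ℂ → ℂ) (v : ℂ) : ℂ := if v = 0 then 0 else φ (1 / 2 + v⁻¹)

lemma atInfty_inv {φ : ℂ → ℂ} {w : ℂ} (hw : w ≠ 1 / 2) : atInfty φ (w - 1 / 2)⁻¹ = φ w := by
  have : w - 1 / 2 ≠ 0 := sub_ne_zero.2 hw
  rw [atInfty, if_neg (inv_ne_zero this), inv_inv, add_sub_cancel]

lemma half_mem_of_norm {v : ℂ} (hv : v ≠ 0) (h : ‖v‖ ≤ 4 / 3) : 3 / 4 ≤ ‖(1 / 2 + v⁻¹) - 1 / 2‖ := by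
  have h0 : 0 < ‖v‖ := by simpa using hv
  rw [add_sub_cancel_left, norm_inv]
  rw [show (3 / 4 : ℝ) = (4 / 3)⁻¹ by norm_num]
  gcongr

lemma differentiableOn_atInfty {φ : ℂ → ℂ} (h : φ ∈ O1 0 1) :
    DifferentiableOn ℂ (atInfty φ) (Metric.closedBall 0 (4 / 3)) := by
  rw [← differentiableOn_compl_singleton_and_continuousAt_iff
    (Metric.closedBall_mem_nhds (0 : ℂ) (by norm_num : (0 : ℝ) < 4 / 3))]
  constructor
  · have : DifferentiableOn ℂ (fun v => φ (1 / 2 + v⁻¹)) (Metric.closedBall 0 (4 / 3) \ {0}) := by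
      refine h.1.comp (t := cutPlane 0 1) ?_ ?_
      · intro v hv
        have : v ≠ 0 := hv.2
        exact ((differentiableAt_inv this).const_add _).differentiableWithinAt
      · intro v hv
        exact mem_cutPlane_of_far (half_mem_of_norm hv.2 (by simpa using hv.1))
    refine this.congr fun v hv => ?_
    have : v ≠ 0 := hv.2
    simp [atInfty, this]
  · rw [continuousAt_iff_punctured_nhds, show atInfty φ 0 = 0 by simp [atInfty]]
    have h1 : Tendsto (fun v : ℂ => 1 / 2 + v⁻¹) (𝓝[≠] 0) (Bornology.cobounded ℂ) :=
      tendsto_const_add_cobounded _ |>.comp tendsto_inv₀_nhdsNE_zero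
    refine (h.2.comp h1).congr' ?_
    filter_upwards [self_mem_nhdsWithin] with v hv
    have : v ≠ 0 := hv
    simp [atInfty, this]

section
variable {φ : ℂ → ℂ} {M : ℝ}

lemma norm_atInfty_le (hM0 : 0 ≤ M) (hM : ∀ w, 3 / 4 ≤ ‖w - 1 / 2‖ → ‖φ w‖ ≤ M) {v : ℂ}
    (hv : ‖v‖ ≤ 4 / 3) : ‖atInfty φ v‖ ≤ M := by
  by_cases h : v = 0
  · simpa [atInfty, h] using hM0
  · rw [atInfty, if_neg h]
    exact hM _ (half_mem_of_norm h hv)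

lemma norm_deriv_atInfty_le (h : φ ∈ O1 0 1) (hM0 : 0 ≤ M)
    (hM : ∀ w, 3 / 4 ≤ ‖w - 1 / 2‖ → ‖φ w‖ ≤ M) {v₀ : ℂ} (hv : ‖v₀‖ ≤ 2 / 3) :
    ‖deriv (atInfty φ) v₀‖ ≤ 3 / 2 * M := by
  have hs : Metric.closedBall v₀ (2 / 3) ⊆ Metric.closedBall 0 (4 / 3) := by
    apply Metric.closedBall_subset_closedBall'
    rw [dist_zero_right]; linarith
  have := norm_deriv_le_of_forall_mem_sphere_norm_le (f := atInfty φ) (c := v₀) (R := 2 / 3) (C := M)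
    (by norm_num) ((differentiableOn_atInfty h).diffContOnCl_ball hs) (fun z hz =>
      norm_atInfty_le hM0 hM (by simpa using hs (Metric.sphere_subset_closedBall hz)))
  linarith

/-- Second order remainder estimate at infinity. -/
lemma norm_atInfty_remainder_le (h : φ ∈ O1 0 1) (hM0 : 0 ≤ M)
    (hM : ∀ w, 3 / 4 ≤ ‖w - 1 / 2‖ → ‖φ w‖ ≤ M) {v v₀ : ℂ} (hv₀ : ‖v₀‖ ≤ 2 / 3)
    (hv : ‖v‖ ≤ 4 / 3) (hne : v ≠ 0) :
    ‖atInfty φ v - atInfty φ v₀ - (v - v₀) * (v₀ / v) * deriv (atInfty φ) v₀‖ ≤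
      8 * M * (‖v - v₀‖ ^ 2 / ‖v‖) := by
  set f := atInfty φ with hf
  have hd := differentiableOn_atInfty h
  have hnhds : Metric.closedBall (0 : ℂ) (4 / 3) ∈ 𝓝 v₀ :=
    mem_of_superset (Metric.isOpen_ball.mem_nhds (by simp; linarith)) Metric.ball_subset_closedBall
  set k : ℂ → ℂ := fun v => v * dslope f v₀ v with hk
  have hkd : DifferentiableOn ℂ k (Metric.closedBall 0 (4 / 3)) :=
    differentiableOn_id.mul ((differentiableOn_dslope hnhds).2 hd)
  set Q := dslope k v₀ with hQ
  have hQd : DifferentiableOn ℂ Q (Metric.closedBall 0 (4 / 3)) :=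
    (differentiableOn_dslope hnhds).2 hkd
  have hD := norm_deriv_atInfty_le h hM0 hM hv₀
  have hkv₀ : k v₀ = v₀ * deriv f v₀ := by simp [hk]
  have hQb : ‖Q v‖ ≤ 8 * M := by
    refine norm_le_of_forall_mem_frontier_norm_le (f := Q) Metric.isBounded_ball (U := Metric.ball 0 (4 / 3))
      (hQd.diffContOnCl_ball subset_rfl) ?_ ?_
    · intro s hs
      rw [frontier_ball _ (by norm_num), mem_sphere_zero_iff_norm] at hs
      have hsv : 2 / 3 ≤ ‖s - v₀‖ := by
        have := norm_sub_norm_le s v₀; linarith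
      have hsne : s ≠ v₀ := by
        rintro rfl; simp at hsv; linarith
      have h1 : ‖k s‖ ≤ 4 * M := by
        rw [hk]; simp only
        rw [dslope_of_ne _ hsne, slope_def_field, norm_mul, norm_div, hs]
        have h2 : ‖f s - f v₀‖ ≤ 2 * M := by
          refine (norm_sub_le _ _).trans ?_
          linarith [norm_atInfty_le hM0 hM hs.le, norm_atInfty_le hM0 hM (v := v₀) (by linarith)]
        have h3 : ‖f s - f v₀‖ / ‖s - v₀‖ ≤ 2 * M / (2 / 3) := by gcongr
        linarith
      have h4 : ‖k v₀‖ ≤ M := by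
        rw [hkv₀, norm_mul]
        nlinarith [norm_nonneg v₀, norm_nonneg (deriv f v₀)]
      rw [hQ, dslope_of_ne _ hsne, slope_def_field, norm_div]
      have h5 : ‖k s - k v₀‖ ≤ 5 * M := (norm_sub_le _ _).trans (by linarith)
      have h6 : ‖k s - k v₀‖ / ‖s - v₀‖ ≤ 5 * M / (2 / 3) := by gcongr
      linarith
    · rw [closure_ball _ (by norm_num)]; simpa using hv
  by_cases hvv : v = v₀
  · subst hvv; simp
  · have hvs : v - v₀ ≠ 0 := sub_ne_zero.2 hvv
    have : f v - f v₀ - (v - v₀) * (v₀ / v) * deriv f v₀ = (v - v₀) ^ 2 / v * Q v := by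
      rw [hQ, dslope_of_ne _ hvv, slope_def_field, hkv₀, hk]
      simp only
      rw [dslope_of_ne _ hvv, slope_def_field]
      field_simp
    rw [this, norm_mul, norm_div, norm_pow, mul_comm]
    gcongr

lemma deriv_eq_atInfty (h : φ ∈ O1 0 1) {w₀ : ℂ} (hw : 3 / 2 ≤ ‖w₀ - 1 / 2‖) :
    deriv φ w₀ = - (w₀ - 1 / 2)⁻¹ ^ 2 * deriv (atInfty φ) (w₀ - 1 / 2)⁻¹ := by
  have h0 : w₀ - 1 / 2 ≠ 0 := by rw [← norm_pos_iff]; linarith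
  have hv : ‖(w₀ - 1 / 2)⁻¹‖ ≤ 2 / 3 := by
    rw [norm_inv, show (2 / 3 : ℝ) = (3 / 2)⁻¹ by norm_num]; gcongr
  have hnhds : Metric.closedBall (0 : ℂ) (4 / 3) ∈ 𝓝 (w₀ - 1 / 2)⁻¹ :=
    mem_of_superset (Metric.isOpen_ball.mem_nhds (by rw [mem_ball_zero_iff]; linarith))
      Metric.ball_subset_closedBall
  have h1 : HasDerivAt (atInfty φ) (deriv (atInfty φ) (w₀ - 1 / 2)⁻¹) (w₀ - 1 / 2)⁻¹ :=
    ((differentiableOn_atInfty h).differentiableAt hnhds).hasDerivAt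
  have h2 : HasDerivAt (fun w : ℂ => (w - 1 / 2)⁻¹) (-(w₀ - 1 / 2)⁻¹ ^ 2) w₀ := by
    have := ((hasDerivAt_id w₀).sub_const (1 / 2)).inv h0
    convert! this using 1
    simp [div_eq_mul_inv]
  have h3 := (h1.comp w₀ h2).congr_of_eventuallyEq (f₁ := φ) (by
    filter_upwards [isOpen_compl_singleton.mem_nhds (sub_ne_zero.1 h0)] with w hw
    exact (atInfty_inv hw).symm)
  rw [h3.deriv, mul_comm]

lemma inv_half_bounds {w₀ : ℂ} (hw : 3 / 2 ≤ ‖w₀ - 1 / 2‖) :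
    w₀ - 1 / 2 ≠ 0 ∧ ‖(w₀ - 1 / 2)⁻¹‖ ≤ 2 / 3 := by
  refine ⟨by rw [← norm_pos_iff]; linarith, ?_⟩
  rw [norm_inv, show (2 / 3 : ℝ) = (3 / 2)⁻¹ by norm_num]; gcongr

lemma norm_deriv_le_of_far (h : φ ∈ O1 0 1) (hM0 : 0 ≤ M)
    (hM : ∀ w, 3 / 4 ≤ ‖w - 1 / 2‖ → ‖φ w‖ ≤ M) {w₀ : ℂ} (hw : 3 / 2 ≤ ‖w₀ - 1 / 2‖) :
    ‖deriv φ w₀‖ ≤ 3 / 2 * M / ‖w₀ - 1 / 2‖ ^ 2 := by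
  obtain ⟨h0, hv⟩ := inv_half_bounds hw
  rw [deriv_eq_atInfty h hw, norm_mul, norm_neg, norm_pow, norm_inv]
  have := norm_deriv_atInfty_le h hM0 hM hv
  rw [div_eq_mul_inv _ (‖w₀ - 1 / 2‖ ^ 2), ← inv_pow, mul_comm]
  gcongr

lemma norm_remainder_le_of_far (h : φ ∈ O1 0 1) (hM0 : 0 ≤ M)
    (hM : ∀ w, 3 / 4 ≤ ‖w - 1 / 2‖ → ‖φ w‖ ≤ M) {w w₀ : ℂ} (hw₀ : 3 / 2 ≤ ‖w₀ - 1 / 2‖)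
    (hw : 3 / 4 ≤ ‖w - 1 / 2‖) :
    ‖φ w - φ w₀ - (w - w₀) * deriv φ w₀‖ ≤
      8 * M * (‖w - w₀‖ ^ 2 / (‖w - 1 / 2‖ * ‖w₀ - 1 / 2‖ ^ 2)) := by
  obtain ⟨h0, hv₀⟩ := inv_half_bounds hw₀
  have h0' : w - 1 / 2 ≠ 0 := by rw [← norm_pos_iff]; linarith
  have hv : ‖(w - 1 / 2)⁻¹‖ ≤ 4 / 3 := by
    rw [norm_inv, show (4 / 3 : ℝ) = (3 / 4)⁻¹ by norm_num]; gcongr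
  have := norm_atInfty_remainder_le h hM0 hM hv₀ hv (inv_ne_zero h0')
  rw [atInfty_inv (sub_ne_zero.1 h0), atInfty_inv (sub_ne_zero.1 h0')] at this
  rw [deriv_eq_atInfty h hw₀]
  have e1 : (w - 1 / 2)⁻¹ - (w₀ - 1 / 2)⁻¹ = (w₀ - w) / ((w - 1 / 2) * (w₀ - 1 / 2)) := by
    rw [inv_sub_inv h0' h0]; congr 1; ring
  convert! this using 2
  · rw [e1]
    generalize deriv (atInfty φ) (w₀ - 1 / 2)⁻¹ = D
    have : ((w₀ - w) / ((w - 1 / 2) * (w₀ - 1 / 2)) * ((w₀ - 1 / 2)⁻¹ / (w - 1 / 2)⁻¹)) =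
        (w - w₀) * (-(w₀ - 1 / 2)⁻¹ ^ 2) := by
      rw [inv_div_inv]
      generalize w - 1 / 2 = a at *
      generalize w₀ - 1 / 2 = b at *
      field_simp
      ring
    rw [this]; ring
  · rw [e1, norm_div, norm_mul, norm_inv, norm_sub_rev w₀ w]
    have h1 : ‖w - 1 / 2‖ ≠ 0 := by simpa using h0'
    have h2 : ‖w₀ - 1 / 2‖ ≠ 0 := by simpa using h0
    generalize ‖w - 1 / 2‖ = a at *
    generalize ‖w₀ - 1 / 2‖ = b at *
    field_simp
end

/-- The conditions on the entries of a non-identity element of `ℳ`. -/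
structure Adm (a b c d : ℤ) : Prop where
  det : a * d - b * c = 1 ∨ a * d - b * c = -1
  a_nonneg : 0 ≤ a
  a_le_b : a ≤ b
  a_le_c : a ≤ c
  b_le_d : b ≤ d
  c_le_d : c ≤ d

namespace Adm
variable {a b c d : ℤ}

lemma one_le_b (h : Adm a b c d) : 1 ≤ b := by
  by_contra! hb
  have h1 := h.a_nonneg
  have h2 := h.a_le_b
  have : a = 0 := by omega
  have : b = 0 := by omega
  subst_vars
  simpa using h.det

lemma one_le_c (h : Adm a b c d) : 1 ≤ c := by
  by_contra! hb
  have h1 := h.a_nonneg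
  have h2 := h.a_le_c
  have : a = 0 := by omega
  have : c = 0 := by omega
  subst_vars
  simpa using h.det

lemma one_le_d (h : Adm a b c d) : 1 ≤ d := h.one_le_b.trans h.b_le_d

lemma norm_det (h : Adm a b c d) : ‖((a * d - b * c : ℤ) : ℂ)‖ = 1 := by
  rcases h.det with h | h <;> rw [h] <;> norm_num

lemma c_ne (h : Adm a b c d) : (c : ℂ) ≠ 0 := by
  have := h.one_le_c
  exact_mod_cast (by omega : c ≠ 0)

lemma d_ne (h : Adm a b c d) : (d : ℂ) ≠ 0 := by
  have := h.one_le_d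
  exact_mod_cast (by omega : d ≠ 0)

lemma one_le_dr (h : Adm a b c d) : (1 : ℝ) ≤ d := by exact_mod_cast h.one_le_d
lemma one_le_cr (h : Adm a b c d) : (1 : ℝ) ≤ c := by exact_mod_cast h.one_le_c
lemma c_le_dr (h : Adm a b c d) : (c : ℝ) ≤ d := by exact_mod_cast h.c_le_d

lemma denom_ne (h : Adm a b c d) {z : ℂ} (hz : z ∈ cutPlane 0 1) : (a : ℂ) - c * z ≠ 0 := by
  intro h0
  apply hz
  have hc := h.one_le_cr
  have ha : (0 : ℝ) ≤ a := by exact_mod_cast h.a_nonneg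
  have hac : (a : ℝ) ≤ c := by exact_mod_cast h.a_le_c
  refine ⟨a / c, ⟨by positivity, ?_⟩, ?_⟩
  · rw [div_le_one] <;> linarith
  · have := h.c_ne
    push_cast
    field_simp
    linear_combination h0

lemma numer_ne (h : Adm a b c d) {z : ℂ} (hz : z ∈ cutPlane 0 1) : (d : ℂ) * z - b ≠ 0 := by
  intro h0
  apply hz
  have hc := h.one_le_dr
  have ha : (1 : ℝ) ≤ b := by exact_mod_cast h.one_le_b
  have hac : (b : ℝ) ≤ d := by exact_mod_cast h.b_le_d
  refine ⟨b / d, ⟨by positivity, ?_⟩, ?_⟩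
  · rw [div_le_one] <;> linarith
  · have := h.d_ne
    push_cast
    field_simp
    linear_combination -h0

lemma moebius_mem (h : Adm a b c d) {z : ℂ} (hz : z ∈ cutPlane 0 1) :
    ((d : ℂ) * z - b) / (a - c * z) ∈ cutPlane 0 1 := by
  rintro ⟨t, ⟨ht0, ht1⟩, ht⟩
  apply hz
  have hu := h.denom_ne hz
  have hc := h.one_le_cr
  have hd := h.one_le_dr
  have ha : (0 : ℝ) ≤ a := by exact_mod_cast h.a_nonneg
  have hb : (1 : ℝ) ≤ b := by exact_mod_cast h.one_le_b
  have hac : (a : ℝ) ≤ c := by exact_mod_cast h.a_le_c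
  have hbd : (b : ℝ) ≤ d := by exact_mod_cast h.b_le_d
  have hpos : 0 < c * t + d := by positivity
  refine ⟨(a * t + b) / (c * t + d), ⟨by positivity, ?_⟩, ?_⟩
  · rw [div_le_one hpos]; nlinarith
  · rw [eq_div_iff hu] at ht
    have : ((c : ℂ) * t + d) ≠ 0 := by exact_mod_cast hpos.ne'
    push_cast
    rw [div_eq_iff this]
    linear_combination ht

lemma far_pole (h : Adm a b c d)
    : 3 / 2 ≤ ‖-(d : ℂ) / c - 1 / 2‖ ∧ (d : ℝ) / c ≤ ‖-(d : ℂ) / c - 1 / 2‖ := by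
  have h1 : -(d : ℂ) / c - 1 / 2 = ((-(d / c + 1 / 2) : ℝ) : ℂ) := by push_cast; ring
  have hc := h.one_le_cr
  have hcd := h.c_le_dr
  have h2 : (1 : ℝ) ≤ d / c := by rw [one_le_div] <;> linarith
  rw [h1, norm_real, norm_neg, Real.norm_of_nonneg (by linarith)]
  constructor <;> linarith

end Adm

/-- The operator `L_g` in terms of the entries of a non-identity `g`. -/
def Lform (a b c d : ℤ) (φ : ℂ → ℂ) (z : ℂ) : ℂ :=
  ((a : ℂ) - c * z) * (φ (((d : ℂ) * z - b) / (a - c * z)) - φ (-(d : ℂ) / c)) -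
    ((a * d - b * c : ℤ) : ℂ) * (c : ℂ)⁻¹ * deriv φ (-(d : ℂ) / c)

section
variable {a b c d : ℤ}

lemma Adm.moebius_facts (h : Adm a b c d)
    {z : ℂ} (hz : z ∈ cutPlane 0 1) {w u : ℂ} (hu : u = a - c * z)
    (hw : w = ((d : ℂ) * z - b) / u) :
    u ≠ 0 ∧ w * u = d * z - b ∧ u * (c * w + d) = ((a * d - b * c : ℤ) : ℂ) ∧
      ‖u‖ * ‖c * w + d‖ = 1 ∧ ‖w‖ * ‖u‖ = ‖(d : ℂ) * z - b‖ := by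
  have hu0 : u ≠ 0 := hu ▸ h.denom_ne hz
  have h1 : w * u = d * z - b := by rw [hw]; field_simp
  have h2 : u * (c * w + d) = ((a * d - b * c : ℤ) : ℂ) := by
    push_cast
    linear_combination c * h1 + d * hu
  refine ⟨hu0, h1, h2, ?_, ?_⟩
  · rw [← norm_mul, h2, h.norm_det]
  · rw [← norm_mul, h1]

lemma Adm.Lform_eq (h : Adm a b c d)
    {φ : ℂ → ℂ} {z : ℂ} (hz : z ∈ cutPlane 0 1) {w u : ℂ} (hu : u = a - c * z)
    (hw : w = ((d : ℂ) * z - b) / u) :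
    Lform a b c d φ z = u * (φ w - φ (-(d : ℂ) / c) - (w - -(d : ℂ) / c) * deriv φ (-(d : ℂ) / c)) := by
  obtain ⟨hu0, h1, h2, -, -⟩ := h.moebius_facts hz hu hw
  have hc := h.c_ne
  rw [Lform, ← h2, ← hu, ← hw]
  field_simp
  ring

lemma Adm.far_estimate (h : Adm a b c d)
    {φ : ℂ → ℂ} (hφ : φ ∈ H1space) {z : ℂ} (hz : z ∈ cutPlane 0 1) {w u : ℂ}
    (hu : u = a - c * z) (hw : w = ((d : ℂ) * z - b) / u) (hfar : 1 ≤ ‖w - 1 / 2‖) :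
    1 / (5 * d) ≤ ‖(d : ℂ) * z - b‖ ∧
    ‖Lform a b c d φ z‖ ≤ 56 * (Hnorm φ).toReal / (d ^ 2 * ‖(d : ℂ) * z - b‖) := by
  obtain ⟨hu0, h1, h2, h3, h4⟩ := h.moebius_facts hz hu hw
  have hd := h.one_le_dr
  have hc := h.one_le_cr
  have hcd := h.c_le_dr
  have hc0 := h.c_ne
  have hu' : 0 < ‖u‖ := by simpa using hu0
  have hwle : ‖w‖ ≤ 3 / 2 * ‖w - 1 / 2‖ := by
    have := norm_add_le (w - 1 / 2) (1 / 2)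
    rw [sub_add_cancel] at this
    norm_num at this
    norm_num at hfar ⊢
    linarith
  have hwge : 1 / 4 ≤ ‖w‖ := by
    have := norm_sub_le w (1 / 2)
    norm_num at this
    norm_num at hfar ⊢
    linarith
  have hN : 0 ≤ (Hnorm φ).toReal := ENNReal.toReal_nonneg
  obtain ⟨hp1, hp2⟩ := h.far_pole
  set D := ‖-(d : ℂ) / c - 1 / 2‖ with hD
  constructor
  · have h5 : ‖c * w + d‖ ≤ d * (‖w‖ + 1) := by
      refine (norm_add_le _ _).trans ?_
      rw [norm_mul, norm_intCast, norm_intCast, abs_of_pos (by linarith), abs_of_pos (by linarith)]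
      nlinarith [norm_nonneg w]
    have h6 : 1 ≤ ‖u‖ * (d * (‖w‖ + 1)) := by
      have := mul_le_mul_of_nonneg_left h5 hu'.le
      rwa [h3] at this
    rw [← h4, div_le_iff₀ (by linarith)]
    nlinarith [mul_pos hu' (by linarith : (0 : ℝ) < d)]
  · have hr := norm_remainder_le_of_far hφ.1 (M := 4 * (Hnorm φ).toReal) (by linarith)
      (fun w hw => norm_le_Hnorm_of_far hφ hw) hp1 (w := w) (by linarith)
    rw [h.Lform_eq hz hu hw, norm_mul]
    refine (mul_le_mul_of_nonneg_left hr hu'.le).trans ?_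
    have e1 : ‖w - -(d : ℂ) / c‖ * (c * ‖u‖) = 1 := by
      rw [← h3, show w - -(d : ℂ) / c = (c * w + d) / c by field_simp; ring, norm_div, norm_intCast,
        abs_of_pos (by linarith)]
      field_simp
    have hw0 : 0 < ‖w‖ := by linarith
    have hX : 0 < ‖(d : ℂ) * z - b‖ := by rw [← h4]; positivity
    have e2 : ‖w - -(d : ℂ) / c‖ = 1 / (c * ‖u‖) := by
      rw [eq_div_iff (by positivity)]; exact e1
    rw [← hD, e2, ← h4]
    have hfarp : 0 < ‖w - 1 / 2‖ := by linarith
    have hDp : (0 : ℝ) < d / c := by positivity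
    calc ‖u‖ * (8 * (4 * (Hnorm φ).toReal) * ((1 / (c * ‖u‖)) ^ 2 / (‖w - 1 / 2‖ * D ^ 2)))
        ≤ ‖u‖ * (8 * (4 * (Hnorm φ).toReal) * ((1 / (c * ‖u‖)) ^ 2 / ((2 / 3 * ‖w‖) * (d / c) ^ 2))) := by
          gcongr
          linarith
      _ = 48 * (Hnorm φ).toReal / (d ^ 2 * (‖w‖ * ‖u‖)) := by
          field_simp
          ring
      _ ≤ _ := by gcongr; norm_num

lemma Adm.near_estimate (h : Adm a b c d)
    {φ : ℂ → ℂ} (hφ : φ ∈ H1space) {z : ℂ} (hz : z ∈ cutPlane 0 1) {w u : ℂ}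
    (hu : u = a - c * z) (hw : w = ((d : ℂ) * z - b) / u) (hnear : ‖w - 1 / 2‖ < 1) :
    ‖(d : ℂ) * z - b‖ ≤ 2 / d * ‖w‖ ∧ ‖w‖ ≤ 3 / 2 ∧
    ‖Lform a b c d φ z‖ ≤ 2 / d * (‖φ w‖ + 12 * (Hnorm φ).toReal) := by
  obtain ⟨hu0, h1, h2, h3, h4⟩ := h.moebius_facts hz hu hw
  have hd := h.one_le_dr
  have hc := h.one_le_cr
  have hcd := h.c_le_dr
  have hc0 := h.c_ne
  have hu' : 0 < ‖u‖ := by simpa using hu0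
  have hN : 0 ≤ (Hnorm φ).toReal := ENNReal.toReal_nonneg
  obtain ⟨hp1, hp2⟩ := h.far_pole
  have hre : -(1 / 2) ≤ w.re := by
    have := (abs_re_le_norm (w - 1 / 2)).trans_lt hnear
    norm_num at this
    have := (abs_lt.1 this).1
    linarith
  have h5 : d / 2 ≤ ‖c * w + d‖ := by
    refine le_trans ?_ (re_le_norm _)
    simp
    nlinarith
  have hu2 : ‖u‖ ≤ 2 / d := by
    rw [le_div_iff₀ (by linarith)]
    nlinarith
  have hw2 : ‖w‖ ≤ 3 / 2 := by
    have := norm_add_le (w - 1 / 2) (1 / 2)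
    rw [sub_add_cancel] at this
    norm_num at this
    norm_num at hnear ⊢
    linarith
  refine ⟨?_, hw2, ?_⟩
  · rw [← h4, mul_comm]; gcongr
  · rw [h.Lform_eq hz hu hw, norm_mul]
    have b0 := norm_le_Hnorm_of_far hφ (w := -(d : ℂ) / c) (by linarith)
    have b1 := norm_deriv_le_of_far hφ.1 (M := 4 * (Hnorm φ).toReal) (by linarith)
      (fun w hw => norm_le_Hnorm_of_far hφ hw) hp1
    set D := ‖-(d : ℂ) / c - 1 / 2‖ with hD
    have b2 : ‖w - -(d : ℂ) / c‖ ≤ 1 + D := by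
      have := norm_sub_le (w - 1 / 2) (-(d : ℂ) / c - 1 / 2)
      rw [sub_sub_sub_cancel_right] at this
      linarith
    have b3 : ‖(w - -(d : ℂ) / c) * deriv φ (-(d : ℂ) / c)‖ ≤ 8 * (Hnorm φ).toReal := by
      rw [norm_mul]
      calc _ ≤ (1 + D) * (3 / 2 * (4 * (Hnorm φ).toReal) / D ^ 2) := by gcongr
        _ ≤ _ := by
          have : 0 < D := by linarith
          rw [mul_div_assoc', div_le_iff₀ (by positivity)]
          nlinarith [mul_nonneg hN (by nlinarith : (0 : ℝ) ≤ 8 * D ^ 2 - 6 * (1 + D))]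
    refine mul_le_mul hu2 ?_ (norm_nonneg _) (by positivity)
    refine (norm_sub_le _ _).trans ?_
    have := norm_sub_le (φ w) (φ (-(d : ℂ) / c))
    linarith

lemma Adm.differentiableOn_Lform (h : Adm a b c d) {φ : ℂ → ℂ} (hφ : φ ∈ O1 0 1) :
    DifferentiableOn ℂ (Lform a b c d φ) (cutPlane 0 1) := by
  have h1 : DifferentiableOn ℂ (fun z : ℂ => φ (((d : ℂ) * z - b) / (a - c * z))) (cutPlane 0 1) := by
    refine hφ.1.comp (t := cutPlane 0 1) ?_ (fun z hz => h.moebius_mem hz)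
    intro z hz
    have e1 : DifferentiableAt ℂ (fun z : ℂ => (d : ℂ) * z - b) z := by fun_prop
    have e2 : DifferentiableAt ℂ (fun z : ℂ => (a : ℂ) - c * z) z := by fun_prop
    exact (e1.div e2 (h.denom_ne hz)).differentiableWithinAt
  have e3 : DifferentiableOn ℂ (fun z : ℂ => (a : ℂ) - c * z) (cutPlane 0 1) := by fun_prop
  exact (e3.mul (h1.sub_const _)).sub_const _

lemma Adm.Lform_mem_O1 (h : Adm a b c d)
    {φ : ℂ → ℂ} (hφ : φ ∈ H1space) : Lform a b c d φ ∈ O1 0 1 := by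
  refine ⟨h.differentiableOn_Lform hφ.1, ?_⟩
  have hd := h.one_le_dr
  have hX : Tendsto (fun z : ℂ => ‖(d : ℂ) * z - b‖) (Bornology.cobounded ℂ) atTop := by
    rw [tendsto_norm_atTop_iff_cobounded]
    exact (tendsto_sub_const_cobounded _).comp (tendsto_mul_left_cobounded h.d_ne)
  have hT : Tendsto (fun z : ℂ => 56 * (Hnorm φ).toReal / (d ^ 2 * ‖(d : ℂ) * z - b‖))
      (Bornology.cobounded ℂ) (𝓝 0) :=
    tendsto_const_nhds.div_atTop (hX.const_mul_atTop (by positivity))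
  refine squeeze_zero_norm' ?_ hT
  filter_upwards [hX.eventually_gt_atTop 3, (tendsto_norm_cobounded_atTop (E := ℂ)).eventually_gt_atTop 1] with z hz hz1
  have hzc : z ∈ cutPlane 0 1 := mem_cutPlane_of_one_lt (by linarith [norm_nonneg (z - 1)])
  by_cases hw : 1 ≤ ‖((d : ℂ) * z - b) / (a - c * z) - 1 / 2‖
  · exact (h.far_estimate hφ hzc rfl rfl hw).2
  · exfalso
    obtain ⟨h1, h2, -⟩ := h.near_estimate hφ hzc rfl rfl (not_le.1 hw)
    have : (2 : ℝ) / d ≤ 2 := by rw [div_le_iff₀] <;> linarith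
    nlinarith [norm_nonneg (((d : ℂ) * z - b) / (a - c * z))]

/-- The self-map of the disc induced by the inverse Möbius transformation. -/
lemma Adm.exists_discMap (h : Adm a b c d) : ∃ Φ : ℂ → ℂ, DifferentiableOn ℂ Φ (Metric.ball 0 1) ∧
    MapsTo Φ (Metric.ball 0 1) (Metric.ball 0 1) ∧ ‖Φ 0‖ ≤ 1 / 2 ∧
    ∀ ζ, ζ ≠ 0 → ‖ζ‖ < 1 → Φ ζ ≠ 0 ∧
      jouk (Φ ζ) = ((d : ℂ) * jouk ζ - b) / (a - c * jouk ζ) := by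
  set ρ : ℂ → ℂ := fun ζ => (((d : ℂ) + c) * (ζ + 1) ^ 2 - 4 * (a + b) * ζ) /
    (d * (ζ + 1) ^ 2 - 4 * b * ζ) with hρ
  have hd := h.one_le_dr
  have hc := h.one_le_cr
  have hd0 := h.d_ne
  have hden : ∀ ζ : ℂ, ‖ζ‖ < 1 → (d * (ζ + 1) ^ 2 - 4 * b * ζ : ℂ) ≠ 0 := by
    intro ζ hζ
    by_cases h0 : ζ = 0
    · simpa [h0] using hd0
    · have := h.numer_ne (jouk_mem_cutPlane h0 hζ)
      rw [jouk, mul_div_assoc', div_sub' (by simpa using h0)] at this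
      intro h'
      apply this
      rw [div_eq_zero_iff]; left
      linear_combination h'
  have hρ0 : ρ 0 = 1 - 1 / (-(d : ℂ) / c) := by
    have := h.c_ne
    simp only [hρ, zero_add, one_pow, mul_one, mul_zero, sub_zero]
    field_simp
    ring
  have hρne : ∀ ζ : ℂ, ζ ≠ 0 → ‖ζ‖ < 1 →
      ρ ζ = 1 - 1 / (((d : ℂ) * jouk ζ - b) / (a - c * jouk ζ)) := by
    intro ζ h0 hζ
    have h1 := h.numer_ne (jouk_mem_cutPlane h0 hζ)
    have h2 := hden ζ hζ
    have e1 : (d : ℂ) * jouk ζ - b = (d * (ζ + 1) ^ 2 - 4 * b * ζ) / (4 * ζ) := by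
      rw [jouk]; field_simp
    have e2 : (a : ℂ) - c * jouk ζ = (4 * a * ζ - c * (ζ + 1) ^ 2) / (4 * ζ) := by
      rw [jouk]; field_simp
    rw [e1, e2, div_div_div_cancel_right₀ (by simpa using h0), one_div_div, eq_sub_iff_add_eq,
      ← add_div, div_eq_one_iff_eq h2]
    ring
  have hslit : ∀ ζ : ℂ, ‖ζ‖ < 1 → ρ ζ ∈ slitPlane := by
    intro ζ hζ
    by_cases h0 : ζ = 0
    · rw [h0, hρ0]
      exact one_sub_inv_mem_slitPlane (mem_cutPlane_of_far (by linarith [h.far_pole.1]))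
    · rw [hρne ζ h0 hζ]
      exact one_sub_inv_mem_slitPlane (h.moebius_mem (jouk_mem_cutPlane h0 hζ))
  have hjk : ∀ w : ℂ, w ∈ cutPlane 0 1 → cayleySqrt (1 - 1 / w) ≠ 0 ∧
      jouk (cayleySqrt (1 - 1 / w)) = w := by
    intro w hw
    have h0 := ne_zero_of_mem_cutPlane hw
    have := jouk_cayleySqrt (one_sub_inv_mem_slitPlane hw) (by simpa using h0)
    exact ⟨this.1, by rw [this.2]; simp⟩
  refine ⟨fun ζ => cayleySqrt (ρ ζ), ?_, ?_, ?_, ?_⟩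
  · intro ζ hζ
    have hζ' : ‖ζ‖ < 1 := by simpa using hζ
    refine (DifferentiableAt.comp ζ (differentiableAt_cayleySqrt (hslit ζ hζ')) ?_).differentiableWithinAt
    exact DifferentiableAt.div (by fun_prop) (by fun_prop) (hden ζ hζ')
  · intro ζ hζ
    have hζ' : ‖ζ‖ < 1 := by simpa using hζ
    simpa using norm_cayleySqrt_lt (hslit ζ hζ')
  · have hfp := h.far_pole.1
    have hw := mem_cutPlane_of_far (w := -(d : ℂ) / c) (by linarith)
    have h1 := hjk _ hw
    have h2 := norm_cayleySqrt_lt (one_sub_inv_mem_slitPlane hw)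
    simp only [hρ0]
    have := norm_le_one_sub_of_le (s := 3 / 2) (t := 1 / 2) h2 h1.1 le_rfl (by norm_num)
      (by rw [h1.2]; exact three_halves_le_of_far (by linarith))
    linarith
  · intro ζ h0 hζ
    simp only [hρne ζ h0 hζ]
    exact hjk _ (h.moebius_mem (jouk_mem_cutPlane h0 hζ))

end

lemma circleAverage_add_of_continuousOn {r : ℝ} (f g : ℂ → ℝ)
    (hf : ContinuousOn f (Metric.sphere 0 |r|)) (hg : ContinuousOn g (Metric.sphere 0 |r|)) :
    Real.circleAverage (fun ζ => f ζ + g ζ) 0 r =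
      Real.circleAverage f 0 r + Real.circleAverage g 0 r :=
  Real.circleAverage_fun_add hf.circleIntegrable' hg.circleIntegrable'

lemma circleAverage_const_mul (r K : ℝ) (f : ℂ → ℝ) :
    Real.circleAverage (fun ζ => K * f ζ) 0 r = K * Real.circleAverage f 0 r :=
  Real.circleAverage_fun_smul (a := K)

lemma circleAverage_norm_sub_rpow_le {β r : ℝ} (hβ0 : 0 < β) (hβ1 : β < 1) (hr0 : 0 < r)
    (hr1 : r < 1) {E : ℂ} (hE : ‖E‖ = 1) :
    ContinuousOn (fun ζ : ℂ => ‖ζ - E‖ ^ (-β)) (Metric.sphere 0 |r|) ∧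
    Real.circleAverage (fun ζ => ‖ζ - E‖ ^ (-β)) 0 r ≤ 1 / Real.cos (β * (Real.pi / 2)) := by
  have hπ := Real.pi_pos
  have hc : 0 < Real.cos (β * (Real.pi / 2)) :=
    Real.cos_pos_of_mem_Ioo ⟨by nlinarith, by nlinarith⟩
  have hcont : ContinuousOn (fun ζ : ℂ => ‖ζ - E‖ ^ (-β)) (Metric.sphere 0 |r|) := by
    refine ContinuousOn.rpow_const (by fun_prop) ?_
    intro ζ hζ
    left
    rw [mem_sphere_zero_iff_norm, abs_of_pos hr0] at hζ
    rw [norm_ne_zero_iff, sub_ne_zero]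
    rintro rfl
    linarith
  refine ⟨hcont, ?_⟩
  set u : ℂ → ℂ := fun ζ => 1 - ζ * (starRingEnd ℂ) E with hu
  have hre : ∀ ζ : ℂ, ‖ζ‖ < 1 → 0 < (u ζ).re := by
    intro ζ hζ
    have := re_le_norm (ζ * (starRingEnd ℂ) E)
    rw [norm_mul, RCLike.norm_conj, hE, mul_one] at this
    simp only [hu, sub_re, one_re]
    linarith
  have hnorm : ∀ ζ, ‖u ζ‖ = ‖ζ - E‖ := by
    intro ζ
    have hEE : E * (starRingEnd ℂ) E = 1 := by
      rw [Complex.mul_conj, normSq_eq_norm_sq, hE]; norm_num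
    rw [show u ζ = -(ζ - E) * (starRingEnd ℂ) E by simp only [hu]; linear_combination -hEE,
      norm_mul, RCLike.norm_conj, hE, mul_one, norm_neg]
  set f : ℂ → ℂ := fun ζ => u ζ ^ (-(β : ℂ)) with hf
  have hfd : DifferentiableOn ℂ f (Metric.ball 0 1) := by
    intro ζ hζ
    have : DifferentiableAt ℂ u ζ := by simp only [hu]; fun_prop
    exact (this.cpow_const (Or.inl (hre ζ (by simpa using hζ)))).differentiableWithinAt
  have hdc : DiffContOnCl ℂ f (Metric.ball 0 |r|) := by
    rw [abs_of_pos hr0]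
    exact diffContOnCl_ball_of_lt_one hfd hr1
  have hci : CircleIntegrable f 0 r := by
    refine ContinuousOn.circleIntegrable' (hfd.continuousOn.mono ?_)
    rw [abs_of_pos hr0]
    exact Metric.sphere_subset_closedBall.trans (Metric.closedBall_subset_ball hr1)
  have hmean : Real.circleAverage (fun ζ => (f ζ).re) 0 r = 1 := by
    have := reCLM.circleAverage_comp_comm hci
    rw [hdc.circleAverage] at this
    simpa [hf, hu, Function.comp_def] using this
  have hpt : ∀ ζ ∈ Metric.sphere (0 : ℂ) |r|,
      ‖ζ - E‖ ^ (-β) ≤ 1 / Real.cos (β * (Real.pi / 2)) * (f ζ).re := by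
    intro ζ hζ
    rw [mem_sphere_zero_iff_norm, abs_of_pos hr0] at hζ
    have h1 := hre ζ (hζ ▸ hr1)
    have hne : u ζ ≠ 0 := by
      intro h; rw [h] at h1; simp at h1
    have harg : |arg (u ζ)| < Real.pi / 2 := abs_arg_lt_pi_div_two_iff.2 (Or.inl h1)
    have hfre : (f ζ).re = ‖ζ - E‖ ^ (-β) * Real.cos (β * |arg (u ζ)|) := by
      have : -(β : ℂ) = ((-β : ℝ) : ℂ) := by push_cast; rfl
      simp only [hf]
      rw [this, cpow_ofReal_re, hnorm]
      congr 1
      rw [← Real.cos_abs, abs_mul, abs_neg, abs_of_pos hβ0, mul_comm]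
    rw [hfre, div_mul_eq_mul_div, one_mul, le_div_iff₀ hc]
    refine mul_le_mul_of_nonneg_left ?_ (by positivity)
    refine Real.cos_le_cos_of_nonneg_of_le_pi (by positivity) (by nlinarith) ?_
    gcongr
  calc _ ≤ Real.circleAverage (fun ζ => 1 / Real.cos (β * (Real.pi / 2)) * (f ζ).re) 0 r := by
        refine Real.circleAverage_mono hcont.circleIntegrable' ?_ hpt
        refine ContinuousOn.circleIntegrable' (continuousOn_const.mul ?_)
        refine continuous_re.comp_continuousOn (hfd.continuousOn.mono ?_)
        rw [abs_of_pos hr0]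
        exact Metric.sphere_subset_closedBall.trans (Metric.closedBall_subset_ball hr1)
    _ = _ := by rw [circleAverage_const_mul, hmean, mul_one]

lemma circleAverage_poissonKernel_mul_norm_Fdisc_comp_le {φ : ℂ → ℂ} (hφ : φ ∈ H1space) {Φ : ℂ → ℂ}
    (hΦ : DifferentiableOn ℂ Φ (Metric.ball 0 1))
    (hm : MapsTo Φ (Metric.ball 0 1) (Metric.ball 0 1)) {p : ℂ} {r : ℝ}
    (hp : ‖p‖ < r) (hr : r < 1) (hq : ‖Φ p‖ ≤ 1 / 2) :
    ContinuousOn (fun ζ => poissonKernel 0 p ζ * (‖Fdisc φ (Φ ζ)‖ + 12 * (Hnorm φ).toReal))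
      (Metric.sphere 0 |r|) ∧
    Real.circleAverage (fun ζ => poissonKernel 0 p ζ *
      (‖Fdisc φ (Φ ζ)‖ + 12 * (Hnorm φ).toReal)) 0 r ≤ 15 * (Hnorm φ).toReal := by
  have hr0 : 0 < r := (norm_nonneg p).trans_lt hp
  have hN : 0 ≤ (Hnorm φ).toReal := ENNReal.toReal_nonneg
  have hF := differentiableOn_Fdisc hφ.1
  have hc1 := continuousOn_poissonKernel_zero hp
  have hc2 : ContinuousOn (fun ζ => ‖Fdisc φ (Φ ζ)‖) (Metric.sphere 0 |r|) :=
    continuousOn_norm_sphere (F := fun ζ => Fdisc φ (Φ ζ)) (hF.comp hΦ hm) hr0 hr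
  refine ⟨hc1.mul (hc2.add continuousOn_const), ?_⟩
  have h1 := circleAverage_poissonKernel_mul_norm_comp_le hF (N := (Hnorm φ).toReal)
    (circleAverage_le_toReal_Hnorm hφ) hΦ hm hp hr
  have h2 : (1 + ‖Φ p‖) / (1 - ‖Φ p‖) ≤ 3 := by
    rw [div_le_iff₀] <;> linarith
  have h3 := mul_le_mul_of_nonneg_right h2 hN
  simp only [mul_add, mul_comm (poissonKernel 0 p _) (12 * (Hnorm φ).toReal)]
  rw [circleAverage_add_of_continuousOn (fun ζ => poissonKernel 0 p ζ * ‖Fdisc φ (Φ ζ)‖)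
    (fun ζ => 12 * (Hnorm φ).toReal * poissonKernel 0 p ζ) (hc1.mul hc2) (continuousOn_const.mul hc1),
    circleAverage_const_mul, circleAverage_poissonKernel hp]
  linarith

section
variable {a b c d : ℤ}

lemma Adm.Hnorm_Lform_le_const_mul (h : Adm a b c d) {φ : ℂ → ℂ} (hφ : φ ∈ H1space) :
    Hnorm (Lform a b c d φ) ≤ ENNReal.ofReal (310 * (Hnorm φ).toReal) := by
  have hN : 0 ≤ (Hnorm φ).toReal := ENNReal.toReal_nonneg
  obtain ⟨Φ, hΦ, hm, hΦ0, hj⟩ := h.exists_discMap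
  have hL := h.Lform_mem_O1 hφ
  have hd := h.one_le_dr
  refine Hnorm_le_of_eventually hL (r₀ := 0) one_pos fun r hr hr0 => ?_
  obtain ⟨hc, hle⟩ := circleAverage_poissonKernel_mul_norm_Fdisc_comp_le hφ hΦ hm (p := 0) (r := r)
    (by simpa using hr0) hr.2 hΦ0
  set G := fun ζ => poissonKernel 0 0 ζ * (‖Fdisc φ (Φ ζ)‖ + 12 * (Hnorm φ).toReal) with hG
  have hmono : Real.circleAverage (fun ζ => ‖Fdisc (Lform a b c d φ) ζ‖) 0 r ≤
      Real.circleAverage (fun ζ => 280 * (Hnorm φ).toReal + 2 * G ζ) 0 r := by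
    refine Real.circleAverage_mono
      (continuousOn_norm_sphere (differentiableOn_Fdisc hL) hr0 hr.2).circleIntegrable'
      (continuousOn_const.add (continuousOn_const.mul hc)).circleIntegrable' ?_
    intro ζ hζ
    rw [mem_sphere_zero_iff_norm, abs_of_pos hr0] at hζ
    have hζ0 : ζ ≠ 0 := by rw [← norm_pos_iff, hζ]; exact hr0
    have hζ1 : ‖ζ‖ < 1 := hζ ▸ hr.2
    have hP : poissonKernel 0 0 ζ = 1 := by
      rw [poissonKernel_def]; simp [hζ0]
    obtain ⟨hΦζ, hjζ⟩ := hj ζ hζ0 hζ1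
    have hz := jouk_mem_cutPlane hζ0 hζ1
    rw [Fdisc_of_ne hζ0]
    simp only [hG, hP, one_mul, Fdisc_of_ne hΦζ, hjζ]
    by_cases hw : 1 ≤ ‖((d : ℂ) * jouk ζ - b) / (a - c * jouk ζ) - 1 / 2‖
    · obtain ⟨h1, h2⟩ := h.far_estimate hφ hz rfl rfl hw
      refine h2.trans ?_
      have hX : 0 < ‖(d : ℂ) * jouk ζ - b‖ := lt_of_lt_of_le (by positivity) h1
      have : 56 * (Hnorm φ).toReal / (d ^ 2 * ‖(d : ℂ) * jouk ζ - b‖) ≤ 280 * (Hnorm φ).toReal := by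
        rw [div_le_iff₀ (by positivity)]
        rw [div_le_iff₀ (by positivity)] at h1
        have h3 : 1 ≤ 5 * (d ^ 2 * ‖(d : ℂ) * jouk ζ - b‖) := by nlinarith [mul_pos hX (by linarith : (0 : ℝ) < d)]
        nlinarith
      have h5 := norm_nonneg (φ (((d : ℂ) * jouk ζ - b) / (a - c * jouk ζ)))
      linarith
    · obtain ⟨-, -, h2⟩ := h.near_estimate hφ hz rfl rfl (not_le.1 hw)
      refine h2.trans ?_
      have : (2 : ℝ) / d ≤ 2 := by rw [div_le_iff₀] <;> linarith
      have h5 := norm_nonneg (φ (((d : ℂ) * jouk ζ - b) / (a - c * jouk ζ)))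
      have := mul_le_mul_of_nonneg_right this (add_nonneg h5 (by positivity : 0 ≤ 12 * (Hnorm φ).toReal))
      linarith
  refine hmono.trans ?_
  rw [circleAverage_add_of_continuousOn (fun _ => 280 * (Hnorm φ).toReal) (fun ζ => 2 * G ζ)
    continuousOn_const (continuousOn_const.mul hc),
    Real.circleAverage_const, circleAverage_const_mul]
  linarith

end

lemma norm_jouk_sub_eq {E ζ : ℂ} {x : ℝ} (hE : ‖E‖ = 1) (hre : E.re = 2 * x - 1) (hζ : ζ ≠ 0) :
    ‖jouk ζ - x‖ = ‖ζ - E‖ * ‖ζ - (starRingEnd ℂ) E‖ / (4 * ‖ζ‖) := by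
  have hEE : E * (starRingEnd ℂ) E = 1 := by
    rw [Complex.mul_conj, normSq_eq_norm_sq, hE]; norm_num
  have hs : E + (starRingEnd ℂ) E = 2 * (2 * x - 1) := by
    rw [add_conj, hre]; push_cast; ring
  have : jouk ζ - x = (ζ - E) * (ζ - (starRingEnd ℂ) E) / (4 * ζ) := by
    rw [jouk]
    field_simp
    linear_combination ζ * hs - hEE
  rw [this, norm_div, norm_mul, norm_mul]
  norm_num

lemma rpow_neg_mul_le {A B s β : ℝ} (hA : 0 < A) (hB : 0 < B) (hs0 : 0 < s) (hs1 : s ≤ 1)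
    (hβ0 : 0 ≤ β) (hβ1 : β ≤ 1) (hAB : 2 * s ≤ A + B) :
    (A * B) ^ (-β) ≤ s⁻¹ * (A ^ (-β) + B ^ (-β)) := by
  have hsb : s ^ (-β) ≤ s⁻¹ := by
    rw [← Real.rpow_neg_one]
    exact Real.rpow_le_rpow_of_exponent_ge hs0 hs1 (by linarith)
  have hA' : 0 ≤ A ^ (-β) := by positivity
  have hB' : 0 ≤ B ^ (-β) := by positivity
  have hs' : 0 ≤ s⁻¹ := by positivity
  rw [Real.mul_rpow hA.le hB.le]
  rcases le_total A B with h | h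
  · have : B ^ (-β) ≤ s⁻¹ :=
      (Real.rpow_le_rpow_of_nonpos hs0 (by linarith) (by linarith)).trans hsb
    nlinarith [mul_le_mul_of_nonneg_left this hA', mul_nonneg hs' hB']
  · have : A ^ (-β) ≤ s⁻¹ :=
      (Real.rpow_le_rpow_of_nonpos hs0 (by linarith) (by linarith)).trans hsb
    nlinarith [mul_le_mul_of_nonneg_left this hB', mul_nonneg hs' hA']

lemma one_le_mul_poissonKernel {E ζ : ℂ} {τ r : ℝ} (hE : ‖E‖ = 1) (hτ0 : 0 < τ) (hτ1 : τ < 1)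
    (hr0 : 0 < r) (hr : 1 - τ / 2 ≤ r ^ 2) (hζ : ‖ζ‖ = r) (hζE : ‖ζ - E‖ ≤ τ) :
    1 ≤ 8 * τ * poissonKernel 0 ((1 - τ : ℝ) * E) ζ := by
  have hp : ‖((1 - τ : ℝ) : ℂ) * E‖ = 1 - τ := by
    rw [norm_mul, hE, norm_real, Real.norm_of_nonneg (by linarith), mul_one]
  have h1 : ‖ζ - (1 - τ : ℝ) * E‖ ≤ 2 * τ := by
    calc _ = ‖(ζ - E) + (τ : ℂ) * E‖ := by push_cast; congr 1; ring
      _ ≤ ‖ζ - E‖ + ‖(τ : ℂ) * E‖ := norm_add_le _ _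
      _ = ‖ζ - E‖ + τ := by rw [norm_mul, hE, norm_real, Real.norm_of_nonneg hτ0.le, mul_one]
      _ ≤ _ := by linarith
  have h2 : 0 < ‖ζ - (1 - τ : ℝ) * E‖ := by
    have := norm_sub_norm_le ζ (((1 - τ : ℝ) : ℂ) * E)
    rw [hζ, hp] at this
    nlinarith
  rw [poissonKernel_def, sub_zero, sub_zero, hζ, hp, mul_div_assoc', le_div_iff₀ (by positivity)]
  have h3 : τ / 2 ≤ r ^ 2 - (1 - τ) ^ 2 := by nlinarith
  have h4 : ‖ζ - (1 - τ : ℝ) * E‖ ^ 2 ≤ (2 * τ) ^ 2 := by gcongr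
  nlinarith

lemma inv_le_rpow_mul_rpow {X P d η : ℝ} (hd : 1 ≤ d) (hη0 : 0 < η) (hη1 : η < 1) (hP : 0 < P)
    (h1 : 1 / (5 * d) ≤ X) (h2 : d * P / 4 ≤ X) :
    1 / (d ^ 2 * X) ≤ 20 * d ^ (2 * η - 3) * P ^ (-(1 - η)) := by
  have hd0 : 0 < d := by linarith
  have hX : 0 < X := lt_of_lt_of_le (by positivity) h1
  have e1 : X⁻¹ = X ^ (-η) * X ^ (-(1 - η)) := by
    rw [← Real.rpow_add hX, ← Real.rpow_neg_one]
    congr 1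
    ring
  have e2 : X ^ (-η) ≤ 5 * d ^ η := by
    calc X ^ (-η) ≤ (1 / (5 * d)) ^ (-η) :=
          Real.rpow_le_rpow_of_nonpos (by positivity) h1 (by linarith)
      _ = 5 ^ η * d ^ η := by
          rw [one_div, Real.inv_rpow (by positivity), Real.rpow_neg (by positivity), inv_inv,
            Real.mul_rpow (by norm_num) hd0.le]
      _ ≤ _ := by
          gcongr
          exact Real.rpow_le_self_of_one_le (by norm_num) hη1.le
  have e3 : X ^ (-(1 - η)) ≤ 4 * d ^ (-(1 - η)) * P ^ (-(1 - η)) := by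
    calc X ^ (-(1 - η)) ≤ (d * P / 4) ^ (-(1 - η)) :=
          Real.rpow_le_rpow_of_nonpos (by positivity) h2 (by linarith)
      _ = 4 ^ (1 - η) * (d ^ (-(1 - η)) * P ^ (-(1 - η))) := by
          rw [Real.div_rpow (by positivity) (by norm_num), Real.mul_rpow hd0.le hP.le,
            Real.rpow_neg (by norm_num : (0 : ℝ) ≤ 4), div_inv_eq_mul, mul_comm]
      _ ≤ 4 * (d ^ (-(1 - η)) * P ^ (-(1 - η))) := by
          gcongr
          exact Real.rpow_le_self_of_one_le (by norm_num) (by linarith)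
      _ = _ := by ring
  have e4 : d ^ (2 * η - 3) = (d ^ 2)⁻¹ * (d ^ η * d ^ (-(1 - η))) := by
    rw [← Real.rpow_natCast, ← Real.rpow_neg hd0.le, ← Real.rpow_add hd0, ← Real.rpow_add hd0]
    congr 1
    push_cast
    ring
  rw [one_div, mul_inv, e4, e1]
  calc (d ^ 2)⁻¹ * (X ^ (-η) * X ^ (-(1 - η)))
      ≤ (d ^ 2)⁻¹ * ((5 * d ^ η) * (4 * d ^ (-(1 - η)) * P ^ (-(1 - η)))) := by gcongr
    _ = _ := by ring

section
variable {a b c d : ℤ}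

lemma Adm.b_le_d_sub_one (h : Adm a b c d) (hd : 1 < d) : b ≤ d - 1 := by
  have : b ≠ d := by
    intro hbd
    have h1 : b * (a - c) = 1 ∨ b * (a - c) = -1 := by
      have := h.det
      rw [← hbd] at this
      rcases this with h | h
      · left; linarith
      · right; linarith
    have hu : IsUnit b := by
      rcases h1 with h1 | h1
      · exact IsUnit.of_mul_eq_one _ h1
      · exact IsUnit.of_mul_eq_one (-(a - c)) (by linarith)
    rcases Int.isUnit_iff.1 hu with hb | hb <;> omega
  have := h.b_le_d
  omega

set_option maxHeartbeats 1000000 in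
lemma Adm.Hnorm_Lform_le_of_five_lt (h : Adm a b c d)
    (hd6 : 5 < d) {η : ℝ} (hη0 : 0 < η) (hη1 : η < 1) {φ : ℂ → ℂ}
    (hφ : φ ∈ H1space) {s : ℝ} (hs0 : 0 < s) (hs : s ^ 2 = 4 * (b * (d - b)) / d ^ 2) :
    Hnorm (Lform a b c d φ) ≤ ENNReal.ofReal
      ((2240 / Real.cos ((1 - η) * (Real.pi / 2)) + 7680) *
        ((d : ℝ) ^ (2 * η - 3) * s⁻¹) * (Hnorm φ).toReal) := by
  set N := (Hnorm φ).toReal with hNdef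
  have hN : 0 ≤ N := ENNReal.toReal_nonneg
  obtain ⟨Φ, hΦ, hm, -, hj⟩ := h.exists_discMap
  have hL := h.Lform_mem_O1 hφ
  have hd : (6 : ℝ) ≤ d := by exact_mod_cast hd6
  have hd0 : (0 : ℝ) < d := by linarith
  have hb1 : (1 : ℝ) ≤ b := by exact_mod_cast h.one_le_b
  have hbd : (b : ℝ) ≤ d := by exact_mod_cast h.b_le_d
  have hbd1 : (b : ℝ) ≤ d - 1 := by exact_mod_cast h.b_le_d_sub_one (by omega)
  have hsd : (s * d) ^ 2 = 4 * (b * (d - b)) := by rw [mul_pow, hs]; field_simp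
  have hs1 : s ≤ 1 := by
    by_contra! h1
    have : d < s * d := by nlinarith
    nlinarith [sq_nonneg ((d : ℝ) - 2 * b)]
  have hsd16 : 16 < d ^ 2 * s := by
    have : 20 ≤ (s * d) ^ 2 := by rw [hsd]; nlinarith
    have h4 : 4 < s * d := by nlinarith [mul_pos hs0 hd0]
    nlinarith
  set τ : ℝ := 16 / (d ^ 2 * s) with hτ
  have hτ0 : 0 < τ := by positivity
  have hτ1 : τ < 1 := by rw [hτ, div_lt_one (by positivity)]; exact hsd16
  have hτs : τ * s = 16 / d ^ 2 := by rw [hτ]; field_simp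
  set x : ℝ := b / d with hx
  have hxX : ∀ z : ℂ, ‖(d : ℂ) * z - b‖ = d * ‖z - x‖ := by
    intro z
    have := h.d_ne
    rw [show (d : ℂ) * z - b = d * (z - x) by rw [hx]; push_cast; field_simp, norm_mul, norm_intCast,
      abs_of_pos hd0]
  set E : ℂ := ⟨2 * x - 1, s⟩ with hE
  have hEn : ‖E‖ = 1 := by
    have : ‖E‖ ^ 2 = 1 := by
      rw [← normSq_eq_norm_sq, normSq_apply, hE]
      simp only
      rw [← sq, ← sq, hs, hx]
      field_simp
      ring
    have h0 := norm_nonneg E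
    nlinarith
  have hEn' : ‖(starRingEnd ℂ) E‖ = 1 := by rw [RCLike.norm_conj, hEn]
  have hEE : ‖E - (starRingEnd ℂ) E‖ = 2 * s := by
    rw [sub_conj, norm_mul, norm_real, norm_I, mul_one, hE, Real.norm_of_nonneg (by positivity)]
  have hAB : ∀ ζ : ℂ, 2 * s ≤ ‖ζ - E‖ + ‖ζ - (starRingEnd ℂ) E‖ := by
    intro ζ
    rw [← hEE, show E - (starRingEnd ℂ) E = (ζ - (starRingEnd ℂ) E) - (ζ - E) by ring, add_comm]
    exact norm_sub_le _ _
  have hj2 : ∀ ζ : ℂ, ζ ≠ 0 → ‖jouk ζ - x‖ =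
      ‖ζ - E‖ * ‖ζ - (starRingEnd ℂ) E‖ / (4 * ‖ζ‖) :=
    fun ζ hζ => norm_jouk_sub_eq hEn rfl hζ
  have hfarp : ∀ p : ℂ, p ≠ 0 → ‖p‖ < 1 → τ * s ≤ ‖p - E‖ * ‖p - (starRingEnd ℂ) E‖ →
      ‖Φ p‖ ≤ 1 / 2 := by
    intro p hp0 hp1 hp
    obtain ⟨hΦ0, hjp⟩ := hj p hp0 hp1
    have hmp : ‖Φ p‖ < 1 := by simpa using hm (by simpa using hp1 : p ∈ Metric.ball (0 : ℂ) 1)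
    have hp0' : 0 < ‖p‖ := by simpa using hp0
    have hfar : 1 ≤ ‖jouk (Φ p) - 1 / 2‖ := by
      by_contra! hnear
      rw [hjp] at hnear
      obtain ⟨h1, h2, -⟩ := h.near_estimate hφ (jouk_mem_cutPlane hp0 hp1) rfl rfl hnear
      have h3 : ‖(d : ℂ) * jouk p - b‖ ≤ 3 / d := h1.trans (by
        calc _ ≤ 2 / d * (3 / 2 : ℝ) := by gcongr
          _ = _ := by ring)
      rw [hxX, hj2 p hp0] at h3
      have h4 : τ * s / 4 ≤ ‖p - E‖ * ‖p - (starRingEnd ℂ) E‖ / (4 * ‖p‖) := by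
        rw [div_le_div_iff₀ (by norm_num) (by positivity)]
        have : 0 < τ * s := by positivity
        nlinarith
      have h5 : d * (τ * s / 4) ≤ 3 / d := (mul_le_mul_of_nonneg_left h4 hd0.le).trans h3
      rw [hτs, le_div_iff₀ hd0] at h5
      field_simp at h5
      norm_num at h5
    have := norm_le_one_sub_of_le (s := 3 / 2) (t := 1 / 2) hmp hΦ0 le_rfl (by norm_num)
      (three_halves_le_of_far (by linarith))
    linarith
  set p₁ : ℂ := ((1 - τ : ℝ) : ℂ) * E with hp₁
  set p₂ : ℂ := ((1 - τ : ℝ) : ℂ) * (starRingEnd ℂ) E with hp₂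
  have hn₁ : ‖p₁‖ = 1 - τ := by
    rw [hp₁, norm_mul, hEn, norm_real, Real.norm_of_nonneg (by linarith), mul_one]
  have hn₂ : ‖p₂‖ = 1 - τ := by
    rw [hp₂, norm_mul, hEn', norm_real, Real.norm_of_nonneg (by linarith), mul_one]
  have hs_im : ∀ w : ℂ, s ≤ |w.im| → s ≤ ‖w‖ := fun w hw => hw.trans (abs_im_le_norm w)
  have hq₁ : ‖Φ p₁‖ ≤ 1 / 2 := by
    refine hfarp p₁ (by rw [← norm_pos_iff]; linarith) (by linarith) ?_
    have e1 : ‖p₁ - E‖ = τ := by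
      rw [show p₁ - E = -((τ : ℂ) * E) by rw [hp₁]; push_cast; ring, norm_neg, norm_mul, hEn,
        norm_real, Real.norm_of_nonneg hτ0.le, mul_one]
    rw [e1]
    refine mul_le_mul_of_nonneg_left (hs_im _ ?_) hτ0.le
    have : (p₁ - (starRingEnd ℂ) E).im = (2 - τ) * s := by
      rw [hp₁, sub_im, im_ofReal_mul, hE, conj_im]; ring
    rw [this, abs_of_pos (by nlinarith)]
    nlinarith
  have hq₂ : ‖Φ p₂‖ ≤ 1 / 2 := by
    refine hfarp p₂ (by rw [← norm_pos_iff]; linarith) (by linarith) ?_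
    have e1 : ‖p₂ - (starRingEnd ℂ) E‖ = τ := by
      rw [show p₂ - (starRingEnd ℂ) E = -((τ : ℂ) * (starRingEnd ℂ) E) by rw [hp₂]; push_cast; ring,
        norm_neg, norm_mul, hEn', norm_real, Real.norm_of_nonneg hτ0.le, mul_one]
    rw [e1, mul_comm]
    refine mul_le_mul_of_nonneg_right (hs_im _ ?_) hτ0.le
    have : (p₂ - E).im = -((2 - τ) * s) := by
      rw [hp₂, sub_im, im_ofReal_mul, conj_im, hE]; ring
    rw [this, abs_neg, abs_of_pos (by nlinarith)]
    nlinarith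
  set β := 1 - η with hβ
  set K : ℝ := 1120 * N * ((d : ℝ) ^ (2 * η - 3) * s⁻¹) with hK
  have hK0 : 0 ≤ K := by positivity
  refine Hnorm_le_of_eventually hL (r₀ := 1 - τ / 4) (by linarith) fun r hr hr0 => ?_
  have hr' : 1 - τ < r := by linarith [hr.1]
  obtain ⟨hA1, hA2⟩ := circleAverage_norm_sub_rpow_le (β := β) (by linarith) (by linarith) hr0 hr.2 hEn
  obtain ⟨hB1, hB2⟩ := circleAverage_norm_sub_rpow_le (β := β) (by linarith) (by linarith) hr0 hr.2 hEn'
  obtain ⟨hG1, hG2⟩ := circleAverage_poissonKernel_mul_norm_Fdisc_comp_le hφ hΦ hm (p := p₁) (r := r)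
    (by linarith) hr.2 hq₁
  obtain ⟨hG1', hG2'⟩ := circleAverage_poissonKernel_mul_norm_Fdisc_comp_le hφ hΦ hm (p := p₂) (r := r)
    (by linarith) hr.2 hq₂
  set f₁ : ℂ → ℝ := fun ζ => ‖ζ - E‖ ^ (-β) with hf₁
  set f₂ : ℂ → ℝ := fun ζ => ‖ζ - (starRingEnd ℂ) E‖ ^ (-β) with hf₂
  set g₁ : ℂ → ℝ := fun ζ => poissonKernel 0 p₁ ζ * (‖Fdisc φ (Φ ζ)‖ + 12 * (Hnorm φ).toReal) with hg₁
  set g₂ : ℂ → ℝ := fun ζ => poissonKernel 0 p₂ ζ * (‖Fdisc φ (Φ ζ)‖ + 12 * (Hnorm φ).toReal) with hg₂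
  have hfc : ContinuousOn (fun ζ => K * (f₁ ζ + f₂ ζ)) (Metric.sphere 0 |r|) :=
    continuousOn_const.mul (hA1.add hB1)
  have hgc : ContinuousOn (fun ζ => 16 * τ / d * (g₁ ζ + g₂ ζ)) (Metric.sphere 0 |r|) :=
    continuousOn_const.mul (hG1.add hG1')
  have hmono : Real.circleAverage (fun ζ => ‖Fdisc (Lform a b c d φ) ζ‖) 0 r ≤
      Real.circleAverage (fun ζ => K * (f₁ ζ + f₂ ζ) + 16 * τ / d * (g₁ ζ + g₂ ζ)) 0 r := by
    refine Real.circleAverage_mono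
      (continuousOn_norm_sphere (differentiableOn_Fdisc hL) hr0 hr.2).circleIntegrable'
      (hfc.add hgc).circleIntegrable' ?_
    intro ζ hζ
    rw [mem_sphere_zero_iff_norm, abs_of_pos hr0] at hζ
    have hζ0 : ζ ≠ 0 := by rw [← norm_pos_iff, hζ]; exact hr0
    have hζ1 : ‖ζ‖ < 1 := hζ ▸ hr.2
    obtain ⟨hΦζ, hjζ⟩ := hj ζ hζ0 hζ1
    have hz := jouk_mem_cutPlane hζ0 hζ1
    have hpos : ∀ E' : ℂ, ‖E'‖ = 1 → 0 < ‖ζ - E'‖ := by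
      intro E' hE'
      rw [norm_pos_iff, sub_ne_zero]
      rintro rfl
      linarith
    have hA := hpos E hEn
    have hB := hpos _ hEn'
    have hP₁ : 0 ≤ poissonKernel 0 p₁ ζ := poissonKernel_zero_nonneg (by linarith)
    have hP₂ : 0 ≤ poissonKernel 0 p₂ ζ := poissonKernel_zero_nonneg (by linarith)
    have hS : 0 ≤ ‖Fdisc φ (Φ ζ)‖ + 12 * (Hnorm φ).toReal := by positivity
    have hXge : d * (‖ζ - E‖ * ‖ζ - (starRingEnd ℂ) E‖) / 4 ≤ ‖(d : ℂ) * jouk ζ - b‖ := by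
      rw [hxX, hj2 ζ hζ0, hζ, mul_div_assoc]
      gcongr
      linarith [hr.2]
    rw [Fdisc_of_ne hζ0]
    by_cases hw : 1 ≤ ‖((d : ℂ) * jouk ζ - b) / (a - c * jouk ζ) - 1 / 2‖
    · obtain ⟨h1, h2⟩ := h.far_estimate hφ hz rfl rfl hw
      have h3 := inv_le_rpow_mul_rpow (by linarith) hη0 hη1 (mul_pos hA hB) h1 hXge
      have h4 := rpow_neg_mul_le hA hB hs0 hs1 (by linarith : 0 ≤ β) (by linarith) (hAB ζ)
      have h5 : 0 ≤ 16 * τ / d * (g₁ ζ + g₂ ζ) := by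
        simp only [hg₁, hg₂]; positivity
      calc _ ≤ 56 * N * (1 / (d ^ 2 * ‖(d : ℂ) * jouk ζ - b‖)) := by
            rw [mul_one_div]; exact h2
        _ ≤ 56 * N * (20 * (d : ℝ) ^ (2 * η - 3) * (s⁻¹ * (f₁ ζ + f₂ ζ))) := by
            refine mul_le_mul_of_nonneg_left (h3.trans ?_) (by positivity)
            exact mul_le_mul_of_nonneg_left h4 (by positivity)
        _ = K * (f₁ ζ + f₂ ζ) := by rw [hK]; ring
        _ ≤ _ := by linarith
    · obtain ⟨h1, h2, h3⟩ := h.near_estimate hφ hz rfl rfl (not_le.1 hw)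
      have h4 : d * (‖ζ - E‖ * ‖ζ - (starRingEnd ℂ) E‖) / 4 ≤ 3 / d :=
        hXge.trans (h1.trans (by
          calc _ ≤ 2 / d * (3 / 2 : ℝ) := by gcongr
            _ = _ := by ring))
      have h5 : ‖ζ - E‖ * ‖ζ - (starRingEnd ℂ) E‖ ≤ τ * s := by
        rw [hτs, le_div_iff₀ (by positivity)]
        rw [div_le_div_iff₀ (by norm_num) hd0] at h4
        nlinarith
      have hr2 : 1 - τ / 2 ≤ r ^ 2 := by nlinarith [hr.1]
      have h6 : 1 ≤ 8 * τ * (poissonKernel 0 p₁ ζ + poissonKernel 0 p₂ ζ) := by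
        have h7 := hAB ζ
        rw [mul_add]
        rcases le_total (‖ζ - E‖) (‖ζ - (starRingEnd ℂ) E‖) with hle | hle
        · have := one_le_mul_poissonKernel hEn hτ0 hτ1 hr0 hr2 hζ (by nlinarith)
          have : 0 ≤ 8 * τ * poissonKernel 0 p₂ ζ := by positivity
          linarith
        · have := one_le_mul_poissonKernel hEn' hτ0 hτ1 hr0 hr2 hζ (by nlinarith)
          have : 0 ≤ 8 * τ * poissonKernel 0 p₁ ζ := by positivity
          linarith
      have h7 : 0 ≤ K * (f₁ ζ + f₂ ζ) := by simp only [hf₁, hf₂]; positivity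
      calc _ ≤ 2 / d * (‖Fdisc φ (Φ ζ)‖ + 12 * (Hnorm φ).toReal) := by
            rw [Fdisc_of_ne hΦζ, hjζ]; exact h3
        _ ≤ 2 / d * ((8 * τ * (poissonKernel 0 p₁ ζ + poissonKernel 0 p₂ ζ)) *
              (‖Fdisc φ (Φ ζ)‖ + 12 * (Hnorm φ).toReal)) := by
            refine mul_le_mul_of_nonneg_left ?_ (by positivity)
            exact le_mul_of_one_le_left hS h6
        _ = 16 * τ / d * (g₁ ζ + g₂ ζ) := by simp only [hg₁, hg₂]; ring
        _ ≤ _ := by linarith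
  refine hmono.trans ?_
  rw [circleAverage_add_of_continuousOn _ _ hfc hgc, circleAverage_const_mul,
    circleAverage_const_mul, circleAverage_add_of_continuousOn f₁ f₂ hA1 hB1,
    circleAverage_add_of_continuousOn g₁ g₂ hG1 hG1']
  have h8 : 16 * τ / d ≤ 256 * ((d : ℝ) ^ (2 * η - 3) * s⁻¹) := by
    have e : 16 * τ / d = 256 * ((d : ℝ) ^ (-3 : ℝ) * s⁻¹) := by
      rw [Real.rpow_neg hd0.le, hτ]
      norm_cast
      field_simp
      norm_num
      ring
    rw [e]
    gcongr <;> linarith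
  have h9 : 0 ≤ 16 * τ / d := by positivity
  calc _ ≤ K * (1 / Real.cos (β * (Real.pi / 2)) + 1 / Real.cos (β * (Real.pi / 2))) +
        16 * τ / d * (15 * N + 15 * N) := by gcongr
    _ ≤ K * (1 / Real.cos (β * (Real.pi / 2)) + 1 / Real.cos (β * (Real.pi / 2))) +
        256 * ((d : ℝ) ^ (2 * η - 3) * s⁻¹) * (15 * N + 15 * N) := by gcongr
    _ = _ := by rw [hK]; ring

end

/-- The weight controlling the norm of `L_g` in terms of the second column `(b, d)` of `g`. -/
def weight (η : ℝ) (b d : ℤ) : ℝ := (d : ℝ) ^ (2 * η - 2) / Real.sqrt (b * (d + 1 - b))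

lemma exists_Hnorm_Lform_le {η : ℝ} (hη0 : 0 < η) (hη1 : η < 1) :
    ∃ C : ℝ, 0 < C ∧ ∀ a b c d : ℤ, Adm a b c d → ∀ φ ∈ H1space,
      Hnorm (Lform a b c d φ) ≤ ENNReal.ofReal (C * weight η b d) * Hnorm φ := by
  have hπ := Real.pi_pos
  have hc : 0 < Real.cos ((1 - η) * (Real.pi / 2)) :=
    Real.cos_pos_of_mem_Ioo ⟨by nlinarith, by nlinarith⟩
  set C₁ := 2240 / Real.cos ((1 - η) * (Real.pi / 2)) + 7680 with hC₁
  have hC₁0 : 0 < C₁ := by positivity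
  refine ⟨C₁ + 38750, by positivity, fun a b c d h φ hφ => ?_⟩
  have hN : 0 ≤ (Hnorm φ).toReal := ENNReal.toReal_nonneg
  have hd := h.one_le_dr
  have hd0 : (0 : ℝ) < d := by linarith
  have hb : (1 : ℝ) ≤ b := by exact_mod_cast h.one_le_b
  have hbd : (b : ℝ) ≤ d := by exact_mod_cast h.b_le_d
  have hq : 0 < Real.sqrt (b * (d + 1 - b)) := Real.sqrt_pos.2 (by nlinarith)
  have hw : 0 < weight η b d := by unfold weight; positivity
  suffices hmain : Hnorm (Lform a b c d φ) ≤
      ENNReal.ofReal ((C₁ + 38750) * weight η b d * (Hnorm φ).toReal) by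
    rwa [ENNReal.ofReal_mul (by positivity), ENNReal.ofReal_toReal hφ.2.ne] at hmain
  by_cases hd5 : 5 < d
  · have hbd1 : (b : ℝ) ≤ d - 1 := by exact_mod_cast h.b_le_d_sub_one (by omega)
    have hpos : 0 < (b : ℝ) * (d - b) := by nlinarith
    have hq' : 0 < Real.sqrt (b * (d - b)) := Real.sqrt_pos.2 hpos
    refine (h.Hnorm_Lform_le_of_five_lt hd5 hη0 hη1 hφ (s := 2 * Real.sqrt (b * (d - b)) / d)
      (by positivity) ?_).trans ?_
    · rw [div_pow, mul_pow, Real.sq_sqrt hpos.le]; norm_num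
    · refine ENNReal.ofReal_le_ofReal (mul_le_mul_of_nonneg_right ?_ hN)
      have e : (d : ℝ) ^ (2 * η - 3) * (2 * Real.sqrt (b * (d - b)) / d)⁻¹ ≤ weight η b d := by
        have e1 : (d : ℝ) ^ (2 * η - 2) = d ^ (2 * η - 3) * d := by
          rw [← Real.rpow_add_one hd0.ne']; congr 1; ring
        have e2 : Real.sqrt (b * (d + 1 - b)) ≤ 2 * Real.sqrt (b * (d - b)) := by
          rw [Real.sqrt_le_left (by positivity), mul_pow, Real.sq_sqrt hpos.le]
          nlinarith
        rw [weight, e1, inv_div, mul_div_assoc]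
        gcongr
      have : C₁ ≤ C₁ + 38750 := by linarith
      gcongr
  · refine (h.Hnorm_Lform_le_const_mul hφ).trans
      (ENNReal.ofReal_le_ofReal (mul_le_mul_of_nonneg_right ?_ hN))
    have hd5' : (d : ℝ) ≤ 5 := by exact_mod_cast not_lt.1 hd5
    have e1 : (1 / 25 : ℝ) ≤ (d : ℝ) ^ (2 * η - 2) := by
      calc (1 / 25 : ℝ) ≤ ((d : ℝ) ^ 2)⁻¹ := by
            rw [one_div]; gcongr; nlinarith
        _ = (d : ℝ) ^ (-2 : ℝ) := by rw [Real.rpow_neg hd0.le]; norm_cast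
        _ ≤ _ := Real.rpow_le_rpow_of_exponent_le hd (by linarith)
    have e2 : Real.sqrt (b * (d + 1 - b)) ≤ 5 := by
      rw [Real.sqrt_le_left (by norm_num)]
      nlinarith
    have e3 : 1 / 125 ≤ weight η b d := by
      rw [weight, le_div_iff₀ hq]
      linarith
    nlinarith

lemma sum_inv_sqrt_le (n : ℕ) : ∑ i ∈ Finset.range n, (Real.sqrt (i + 1))⁻¹ ≤ 2 * Real.sqrt n := by
  induction n with
  | zero => simp
  | succ n ih =>
    rw [Finset.sum_range_succ]
    push_cast
    have h1 : 0 < Real.sqrt (n + 1) := Real.sqrt_pos.2 (by positivity)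
    have h2 := Real.sqrt_nonneg (n : ℝ)
    have h3 : Real.sqrt (n + 1) ^ 2 = n + 1 := Real.sq_sqrt (by positivity)
    have h4 : Real.sqrt n ^ 2 = (n : ℝ) := Real.sq_sqrt (by positivity)
    have h5 : (Real.sqrt (n + 1))⁻¹ ≤ 2 * (Real.sqrt (n + 1) - Real.sqrt n) := by
      rw [inv_le_iff_one_le_mul₀ h1]
      nlinarith [sq_nonneg (Real.sqrt (n + 1) - Real.sqrt n)]
    linarith

lemma sum_inv_sqrt_mul_le (n : ℕ) :
    ∑ i ∈ Finset.range n, (Real.sqrt ((i + 1) * (n - i)))⁻¹ ≤ 4 := by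
  have hterm : ∀ i ∈ Finset.range n, (Real.sqrt ((i + 1) * (n - i)))⁻¹ ≤
      (Real.sqrt (n + 1))⁻¹ * ((Real.sqrt (i + 1))⁻¹ + (Real.sqrt ((n - 1 - i : ℕ) + 1))⁻¹) := by
    intro i hi
    have hi' := Finset.mem_range.1 hi
    have hcast : ((n - 1 - i : ℕ) : ℝ) + 1 = n - i := by
      have : (n - 1 - i : ℕ) + 1 + i = n := by omega
      have h' : ((n - 1 - i : ℕ) : ℝ) + 1 + i = n := by exact_mod_cast this
      linarith
    rw [hcast]
    have hp : (0 : ℝ) < n - i := by rw [sub_pos]; exact_mod_cast hi'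
    have hs1 : 0 < Real.sqrt (i + 1) := Real.sqrt_pos.2 (by positivity)
    have hs2 : 0 < Real.sqrt (n - i) := Real.sqrt_pos.2 hp
    have hs3 : 0 < Real.sqrt (n + 1) := Real.sqrt_pos.2 (by positivity)
    rw [Real.sqrt_mul (by positivity), mul_inv]
    have key : Real.sqrt (n + 1) ≤ Real.sqrt (i + 1) + Real.sqrt (n - i) := by
      rw [Real.sqrt_le_left (by positivity), add_sq, Real.sq_sqrt (by positivity), Real.sq_sqrt hp.le]
      nlinarith [mul_pos hs1 hs2]
    rw [inv_mul_eq_div (Real.sqrt (n + 1)), le_div_iff₀ hs3]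
    calc _ ≤ (Real.sqrt (i + 1))⁻¹ * (Real.sqrt (n - i))⁻¹ *
          (Real.sqrt (i + 1) + Real.sqrt (n - i)) := by gcongr
      _ = _ := by field_simp; ring
  refine (Finset.sum_le_sum hterm).trans ?_
  rw [← Finset.mul_sum, Finset.sum_add_distrib,
    Finset.sum_range_reflect (fun i : ℕ => (Real.sqrt ((i : ℝ) + 1))⁻¹)]
  have h := sum_inv_sqrt_le n
  have hs3 : 0 < Real.sqrt (n + 1) := Real.sqrt_pos.2 (by positivity)
  have h2 : Real.sqrt n ≤ Real.sqrt (n + 1) := Real.sqrt_le_sqrt (by linarith)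
  rw [← div_eq_inv_mul, div_le_iff₀ hs3]
  linarith

lemma weight_nonneg (η : ℝ) {b d : ℤ} (hd : 0 ≤ d) : 0 ≤ weight η b d := by
  have : (0 : ℝ) ≤ d := by exact_mod_cast hd
  unfold weight
  positivity

lemma tsum_weight_le (η : ℝ) (d : ℕ) :
    ∑' b : ℕ, ENNReal.ofReal (weight η b d) ≤ ENNReal.ofReal (4 * (d : ℝ) ^ (2 * η - 2)) := by
  have hsupp : ∀ b ∉ Finset.range (d + 1), ENNReal.ofReal (weight η b d) = 0 := by
    intro b hb
    have hb' : d + 1 ≤ b := by simpa using hb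
    have : (d : ℝ) + 1 ≤ b := by exact_mod_cast hb'
    rw [weight, Real.sqrt_eq_zero_of_nonpos, div_zero, ENNReal.ofReal_zero]
    push_cast
    exact mul_nonpos_of_nonneg_of_nonpos (by positivity) (by linarith)
  rw [tsum_eq_sum hsupp, ← ENNReal.ofReal_sum_of_nonneg (fun b _ => weight_nonneg η (by positivity))]
  refine ENNReal.ofReal_le_ofReal ?_
  rw [Finset.sum_range_succ']
  have h0 : weight η ((0 : ℕ) : ℤ) d = 0 := by simp [weight]
  rw [h0, add_zero]
  have h := mul_le_mul_of_nonneg_left (sum_inv_sqrt_mul_le d)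
    (by positivity : 0 ≤ (d : ℝ) ^ (2 * η - 2))
  rw [mul_comm 4, ]
  refine le_trans (le_of_eq ?_) h
  rw [Finset.mul_sum]
  refine Finset.sum_congr rfl fun i _ => ?_
  rw [weight, div_eq_mul_inv]
  push_cast
  congr 4
  ring

lemma tsum_prod_weight_lt_top {η : ℝ} (hη : η < 1 / 2) :
    ∑' p : ℕ × ℕ, ENNReal.ofReal (weight η p.1 p.2) < ⊤ := by
  rw [ENNReal.tsum_prod', ENNReal.tsum_comm]
  refine lt_of_le_of_lt (ENNReal.tsum_le_tsum fun d => tsum_weight_le η d) ?_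
  have hs : Summable fun d : ℕ => 4 * (d : ℝ) ^ (2 * η - 2) :=
    (Real.summable_nat_rpow.2 (by linarith)).mul_left 4
  rw [← ENNReal.ofReal_tsum_of_nonneg (fun d => by positivity) hs]
  exact ENNReal.ofReal_lt_top

lemma adm_of_mem {g : Matrix (Fin 2) (Fin 2) ℤ} (hg : g ∈ Mmon) (h1 : g ≠ 1) :
    Adm (g 0 0) (g 0 1) (g 1 0) (g 1 1) := by
  rcases hg with hg | ⟨h2, h3, h4, h5, h6, h7⟩
  · exact absurd hg h1
  · exact ⟨h2, h5, h4, h7, h3, h6⟩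

lemma Adm.unique {a b c d a' c' : ℤ} (h : Adm a b c d) (h' : Adm a' b c' d)
    (hdet : a * d - b * c = a' * d - b * c') : a = a' ∧ c = c' := by
  have hcop : IsCoprime d b := by
    rcases h.det with h | h
    · exact ⟨a, -c, by linarith⟩
    · exact ⟨-a, c, by linarith⟩
  have hdvd : d ∣ b * (c - c') := ⟨a - a', by linarith⟩
  have hdvd' := hcop.dvd_of_dvd_mul_left hdvd
  have h1 := h.one_le_c
  have h2 := h'.one_le_c
  have h3 := h.c_le_d
  have h4 := h'.c_le_d
  have hcc : c - c' = 0 := Int.eq_zero_of_abs_lt_dvd hdvd' (by rw [abs_lt]; omega)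
  have hcc' : c = c' := by linarith
  refine ⟨?_, hcc'⟩
  rw [hcc'] at hdet
  have : a * d = a' * d := by linarith
  exact mul_right_cancel₀ (by have := h.one_le_d; omega) this

/-- The second column of `g ∈ ℳ` together with a code for its determinant. -/
def columnCode (g : Mmon) : (ℕ × ℕ) × Fin 3 :=
  (((g.1 0 1).toNat, (g.1 1 1).toNat),
    if g.1 = 1 then 0 else if g.1 0 0 * g.1 1 1 - g.1 0 1 * g.1 1 0 = 1 then 1 else 2)

lemma columnCode_injective : Function.Injective columnCode := by
  rintro ⟨g, hg⟩ ⟨g', hg'⟩ h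
  simp only [columnCode, Prod.mk.injEq] at h
  obtain ⟨⟨hb, hd⟩, hc⟩ := h
  rw [Subtype.mk.injEq]
  by_cases h1 : g = 1
  · by_cases h2 : g' = 1
    · rw [h1, h2]
    · simp only [h1, h2, if_true, if_false] at hc
      split_ifs at hc <;> simp at hc
  · by_cases h2 : g' = 1
    · simp only [h1, h2, if_true, if_false] at hc
      split_ifs at hc <;> simp at hc
    · have A := adm_of_mem hg h1
      have A' := adm_of_mem hg' h2
      have := A.one_le_b
      have := A.one_le_d
      have := A'.one_le_b
      have := A'.one_le_d
      have hb' : g 0 1 = g' 0 1 := by omega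
      have hd' : g 1 1 = g' 1 1 := by omega
      have hdet : g 0 0 * g 1 1 - g 0 1 * g 1 0 = g' 0 0 * g' 1 1 - g' 0 1 * g' 1 0 := by
        rw [if_neg h1, if_neg h2] at hc
        have d1 := A.det
        have d2 := A'.det
        split_ifs at hc with e1 e2 e2
        · rw [e1, e2]
        · simp at hc
        · simp at hc
        · rw [d1.resolve_left e1, d2.resolve_left e2]
      rw [← hb', ← hd'] at A' hdet
      obtain ⟨ha, hcc⟩ := A.unique A' hdet
      ext i j
      fin_cases i <;> fin_cases j <;> simp [ha, hcc, hb', hd']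

lemma tsum_Mmon_weight_lt_top {η : ℝ} (hη : η < 1 / 2) :
    ∑' g : Mmon, ENNReal.ofReal (weight η (g.1 0 1) (g.1 1 1)) < ⊤ := by
  set W : (ℕ × ℕ) × Fin 3 → ℝ≥0∞ := fun q => ENNReal.ofReal (weight η q.1.1 q.1.2) with hW
  have hle : ∀ g : Mmon, ENNReal.ofReal (weight η (g.1 0 1) (g.1 1 1)) ≤ W (columnCode g) := by
    rintro ⟨g, hg⟩
    simp only [columnCode, hW]
    by_cases h1 : g = 1
    · subst h1
      simp [weight]
    · have A := adm_of_mem hg h1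
      rw [Int.toNat_of_nonneg (by have := A.one_le_b; omega),
        Int.toNat_of_nonneg (by have := A.one_le_d; omega)]
  refine lt_of_le_of_lt (ENNReal.tsum_le_tsum hle) ?_
  refine lt_of_le_of_lt (ENNReal.tsum_comp_le_tsum_of_injective columnCode_injective W) ?_
  rw [ENNReal.tsum_prod']
  simp only [hW, tsum_fintype, Finset.sum_const, Finset.card_univ, Fintype.card_fin, nsmul_eq_mul]
  rw [ENNReal.tsum_mul_left]
  exact ENNReal.mul_lt_top (by simp) (tsum_prod_weight_lt_top hη)

lemma weight_le_mul {η D : ℝ} (hη : η ≤ 1 / 3) {b d : ℤ} (hD : 0 < D) (hDd : D ≤ d) :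
    weight η b d ≤ D ^ (-(1 - 3 * η)) * weight ((1 - η) / 2) b d := by
  have hd : (0 : ℝ) < d := by linarith
  have e : (d : ℝ) ^ (2 * η - 2) = d ^ (-(1 - 3 * η)) * d ^ (2 * ((1 - η) / 2) - 2) := by
    rw [← Real.rpow_add hd]; congr 1; ring
  rw [weight, weight, e, mul_div_assoc]
  have : (d : ℝ) ^ (-(1 - 3 * η)) ≤ D ^ (-(1 - 3 * η)) :=
    Real.rpow_le_rpow_of_nonpos hD hDd (by linarith)
  gcongr

lemma exists_isOpen_norm_le_Hnorm {z : ℂ} (hz : z ∈ cutPlane 0 1) :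
    ∃ U : Set ℂ, IsOpen U ∧ z ∈ U ∧ U ⊆ cutPlane 0 1 ∧
      ∃ K : ℝ, 0 ≤ K ∧ ∀ w ∈ U, ∀ φ ∈ H1space, ‖φ w‖ ≤ K * (Hnorm φ).toReal := by
  obtain ⟨s, hs1, hs2⟩ := exists_between (one_lt_norm_add_norm_of_mem hz)
  set t := min (1 / 2) (Real.sqrt (s - 1)) with ht
  have hq : 0 < Real.sqrt (s - 1) := Real.sqrt_pos.2 (by linarith)
  have ht0 : 0 < t := lt_min (by norm_num) hq
  have ht2 : t ^ 2 ≤ s - 1 := by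
    rw [← Real.sq_sqrt (by linarith : 0 ≤ s - 1)]
    gcongr
    exact min_le_right _ _
  refine ⟨{w | s < ‖w‖ + ‖w - 1‖}, isOpen_lt continuous_const (by fun_prop), hs2,
    fun w hw => mem_cutPlane_of_one_lt (hs1.trans hw), 2 / t, by positivity, ?_⟩
  intro w hw φ hφ
  exact norm_le_Hnorm hφ ht0 (min_le_left _ _) ht2 (le_of_lt hw)

section
variable {ι : Type*} {ψ : ι → ℂ → ℂ}

lemma summable_norm_of_tsum_Hnorm (hψ : ∀ i, ψ i ∈ H1space) (hS : ∑' i, Hnorm (ψ i) < ⊤)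
    {z : ℂ} (hz : z ∈ cutPlane 0 1) : Summable fun i => ‖ψ i z‖ := by
  obtain ⟨U, -, hzU, -, K, -, hK⟩ := exists_isOpen_norm_le_Hnorm hz
  exact Summable.of_nonneg_of_le (fun i => norm_nonneg _) (fun i => hK z hzU _ (hψ i))
    ((ENNReal.summable_toReal hS.ne).mul_left K)

lemma hasSum_deriv_of_tsum_Hnorm (hψ : ∀ i, ψ i ∈ H1space) (hS : ∑' i, Hnorm (ψ i) < ⊤)
    {z : ℂ} (hz : z ∈ cutPlane 0 1) :
    HasSum (fun i => deriv (ψ i) z) (deriv (fun w => ∑' i, ψ i w) z) := by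
  obtain ⟨U, hU, hzU, hUs, K, -, hK⟩ := exists_isOpen_norm_le_Hnorm hz
  exact hasSum_deriv_of_summable_norm ((ENNReal.summable_toReal hS.ne).mul_left K)
    (fun i => (hψ i).1.1.mono hUs) hU (fun i w hw => hK w hw _ (hψ i)) hzU

lemma tsum_mem_O1 (hψ : ∀ i, ψ i ∈ H1space) (hS : ∑' i, Hnorm (ψ i) < ⊤)
    : (fun z => ∑' i, ψ i z) ∈ O1 0 1 := by
  have hsum := ENNReal.summable_toReal hS.ne
  constructor
  · intro z hz
    obtain ⟨U, hU, hzU, hUs, K, -, hK⟩ := exists_isOpen_norm_le_Hnorm hz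
    have := differentiableOn_tsum_of_summable_norm (hsum.mul_left K)
      (fun i => (hψ i).1.1.mono hUs) hU (fun i w hw => hK w hw _ (hψ i))
    exact (this.differentiableAt (hU.mem_nhds hzU)).differentiableWithinAt
  · have := tendsto_tsum_of_dominated_convergence (f := fun z i => ψ i z) (g := fun _ => 0)
      (𝓕 := Bornology.cobounded ℂ) (hsum.mul_left 4) (fun i => (hψ i).1.2) ?_
    · simpa using this
    · filter_upwards [(tendsto_norm_cobounded_atTop (E := ℂ)).eventually_gt_atTop 2] with z hz i
      refine norm_le_Hnorm_of_far (hψ i) ?_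
      have := norm_sub_norm_le z (1 / 2)
      norm_num at this ⊢
      linarith

lemma Hnorm_tsum_le (hψ : ∀ i, ψ i ∈ H1space) (hS : ∑' i, Hnorm (ψ i) < ⊤)
    : Hnorm (fun z => ∑' i, ψ i z) ≤ ∑' i, Hnorm (ψ i) := by
  have hsum := ENNReal.summable_toReal hS.ne
  have hO := tsum_mem_O1 hψ hS
  have hrhs : ∑' i, Hnorm (ψ i) = ENNReal.ofReal (∑' i, (Hnorm (ψ i)).toReal) := by
    rw [ENNReal.ofReal_tsum_of_nonneg (fun i => ENNReal.toReal_nonneg) hsum]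
    exact tsum_congr fun i => (ENNReal.ofReal_toReal (hψ i).2.ne).symm
  rw [hrhs]
  refine Hnorm_le_of_eventually hO (r₀ := 0) one_pos fun r hr hr0 => ?_
  obtain ⟨K, hK⟩ : ∃ K : ℝ, ∀ ζ ∈ Metric.sphere (0 : ℂ) |r|, ∀ φ ∈ H1space,
      ‖Fdisc φ ζ‖ ≤ K * (Hnorm φ).toReal := by
    refine ⟨(1 + r) / (1 - r), fun ζ hζ φ hφ => ?_⟩
    rw [mem_sphere_zero_iff_norm, abs_of_pos hr0] at hζ
    rw [← hζ]
    exact norm_le_of_circleAverage_le (differentiableOn_Fdisc hφ.1)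
      (circleAverage_le_toReal_Hnorm hφ) (hζ.trans_lt hr.2)
  set S := ∑' i, (Hnorm (ψ i)).toReal with hSdef
  have hlim : Tendsto (fun s : Finset ι => ∑ i ∈ s, (Hnorm (ψ i)).toReal +
      K * (S - ∑ i ∈ s, (Hnorm (ψ i)).toReal)) atTop (𝓝 (S + K * (S - S))) := by
    have ht : Tendsto (fun s : Finset ι => ∑ i ∈ s, (Hnorm (ψ i)).toReal) atTop (𝓝 S) :=
      hsum.hasSum
    exact ht.add ((tendsto_const_nhds.sub ht).const_mul K)
  rw [sub_self, mul_zero, add_zero] at hlim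
  refine ge_of_tendsto' hlim fun s => ?_
  have hc : ∀ i, ContinuousOn (fun ζ => ‖Fdisc (ψ i) ζ‖) (Metric.sphere 0 |r|) := fun i =>
    continuousOn_norm_sphere (differentiableOn_Fdisc (hψ i).1) hr0 hr.2
  have hcs : ContinuousOn (fun ζ => ∑ i ∈ s, ‖Fdisc (ψ i) ζ‖) (Metric.sphere 0 |r|) :=
    continuousOn_finsetSum s fun i _ => hc i
  calc _ ≤ Real.circleAverage (fun ζ => ∑ i ∈ s, ‖Fdisc (ψ i) ζ‖ +
        K * (S - ∑ i ∈ s, (Hnorm (ψ i)).toReal)) 0 r := by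
        refine Real.circleAverage_mono
          (continuousOn_norm_sphere (differentiableOn_Fdisc hO) hr0 hr.2).circleIntegrable'
          (hcs.add continuousOn_const).circleIntegrable' fun ζ hζ => ?_
        have hb : ∀ i, ‖Fdisc (ψ i) ζ‖ ≤ K * (Hnorm (ψ i)).toReal := fun i => hK ζ hζ _ (hψ i)
        have hζ0 : ζ ≠ 0 := by
          rw [mem_sphere_zero_iff_norm, abs_of_pos hr0] at hζ
          rw [← norm_pos_iff, hζ]; exact hr0
        have hn : Summable fun i => ‖Fdisc (ψ i) ζ‖ :=
          Summable.of_nonneg_of_le (fun i => norm_nonneg _) hb (hsum.mul_left K)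
        have e : Fdisc (fun z => ∑' i, ψ i z) ζ = ∑' i, Fdisc (ψ i) ζ := by
          simp only [Fdisc_of_ne hζ0]
        rw [e]
        refine (norm_tsum_le_tsum_norm hn).trans ?_
        rw [← hn.sum_add_tsum_compl (s := s), hSdef, ← hsum.sum_add_tsum_compl (s := s),
          add_sub_cancel_left, ← tsum_mul_left]
        gcongr
        · exact hn.subtype _
        · exact (hsum.mul_left K).subtype _
        · exact hb _
    _ = ∑ i ∈ s, Real.circleAverage (fun ζ => ‖Fdisc (ψ i) ζ‖) 0 r +
        K * (S - ∑ i ∈ s, (Hnorm (ψ i)).toReal) := by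
        rw [circleAverage_add_of_continuousOn _ _ hcs continuousOn_const, Real.circleAverage_const,
          Real.circleAverage_fun_sum fun i _ => (hc i).circleIntegrable']
    _ ≤ _ := by
        gcongr with i
        exact circleAverage_le_toReal_Hnorm (hψ i) r hr

lemma tsum_mem_H1space (hψ : ∀ i, ψ i ∈ H1space) (hS : ∑' i, Hnorm (ψ i) < ⊤)
    : (fun z => ∑' i, ψ i z) ∈ H1space :=
  ⟨tsum_mem_O1 hψ hS, (Hnorm_tsum_le hψ hS).trans_lt hS⟩

end

lemma Lop_one (φ : ℂ → ℂ) : Lop 1 φ = φ := by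
  funext z
  simp [Lop]

lemma Lop_eq_Lform {g : Matrix (Fin 2) (Fin 2) ℤ} (h1 : g ≠ 1) (φ : ℂ → ℂ) :
    Lop g φ = Lform (g 0 0) (g 0 1) (g 1 0) (g 1 1) φ := by
  funext z
  simp [Lop, Lform, h1]

/-- A bound for the norm of `L_g` on `H¹`. -/
def opBound (C η : ℝ) (g : Matrix (Fin 2) (Fin 2) ℤ) : ℝ≥0∞ :=
  if g = 1 then 1 else ENNReal.ofReal (C * weight η (g 0 1) (g 1 1))

lemma exists_Hnorm_Lop_le {η : ℝ} (hη0 : 0 < η) (hη1 : η < 1) :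
    ∃ C > 0, ∀ g ∈ Mmon, ∀ φ ∈ H1space, Hnorm (Lop g φ) ≤ opBound C η g * Hnorm φ := by
  obtain ⟨C, hC, h⟩ := exists_Hnorm_Lform_le hη0 hη1
  refine ⟨C, hC, fun g hg φ hφ => ?_⟩
  by_cases h1 : g = 1
  · simp [h1, opBound, Lop_one]
  · rw [opBound, if_neg h1, Lop_eq_Lform h1]
    exact h _ _ _ _ (adm_of_mem hg h1) φ hφ

lemma opBound_lt_top (C η : ℝ) (g : Matrix (Fin 2) (Fin 2) ℤ) : opBound C η g < ⊤ := by
  unfold opBound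
  split_ifs
  · exact ENNReal.one_lt_top
  · exact ENNReal.ofReal_lt_top

lemma tsum_opBound_lt_top {C η : ℝ} (hC : 0 ≤ C) (hη : η < 1 / 2) :
    ∑' g : Mmon, opBound C η g.1 < ⊤ := by
  have hle : ∀ g : Mmon, opBound C η g.1 ≤ (if g = ⟨1, Or.inl rfl⟩ then 1 else 0) +
      ENNReal.ofReal C * ENNReal.ofReal (weight η (g.1 0 1) (g.1 1 1)) := by
    intro g
    by_cases h1 : g.1 = 1
    · have : g = ⟨1, Or.inl rfl⟩ := Subtype.ext h1
      rw [opBound, if_pos h1, if_pos this]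
      exact le_self_add
    · rw [opBound, if_neg h1, ENNReal.ofReal_mul hC]
      exact le_add_self
  refine (ENNReal.tsum_le_tsum hle).trans_lt ?_
  rw [ENNReal.tsum_add, tsum_ite_eq, ENNReal.tsum_mul_left]
  exact ENNReal.add_lt_top.2
    ⟨ENNReal.one_lt_top, ENNReal.mul_lt_top ENNReal.ofReal_lt_top (tsum_Mmon_weight_lt_top hη)⟩

lemma Lop_mem_H1space {g : Matrix (Fin 2) (Fin 2) ℤ} (hg : g ∈ Mmon) {φ : ℂ → ℂ}
    (hφ : φ ∈ H1space) : Lop g φ ∈ H1space := by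
  by_cases h1 : g = 1
  · rwa [h1, Lop_one]
  · obtain ⟨C, -, h⟩ := exists_Hnorm_Lop_le (η := 1 / 4) (by norm_num) (by norm_num)
    refine ⟨?_, (h g hg φ hφ).trans_lt (ENNReal.mul_lt_top (opBound_lt_top _ _ _) hφ.2)⟩
    rw [Lop_eq_Lform h1]
    exact (adm_of_mem hg h1).Lform_mem_O1 hφ

lemma tsum_Hnorm_Lop_lt_top {φ : ℂ → ℂ} (hφ : φ ∈ H1space) :
    ∑' g : Mmon, Hnorm (Lop g.1 φ) < ⊤ := by
  obtain ⟨C, hC, h⟩ := exists_Hnorm_Lop_le (η := 1 / 4) (by norm_num) (by norm_num)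
  refine (ENNReal.tsum_le_tsum fun g : Mmon => h g.1 g.2 φ hφ).trans_lt ?_
  rw [ENNReal.tsum_mul_right]
  exact ENNReal.mul_lt_top (tsum_opBound_lt_top hC.le (by norm_num)) hφ.2

/-- Words of length `k` in the generators `g(m)`, `m ≥ 1`. -/
def Word : ℕ → Type
  | 0 => Unit
  | k + 1 => ℕ × Word k

/-- The product of the generators of a word. -/
def wordMat : (k : ℕ) → Word k → Matrix (Fin 2) (Fin 2) ℤ
  | 0, _ => 1
  | k + 1, w => gmat (w.1 + 1) * wordMat k w.2

lemma gmat_mul_entries (n : ℤ) (g : Matrix (Fin 2) (Fin 2) ℤ) :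
    (gmat n * g) 0 0 = g 1 0 ∧ (gmat n * g) 0 1 = g 1 1 ∧
      (gmat n * g) 1 0 = g 0 0 + n * g 1 0 ∧ (gmat n * g) 1 1 = g 0 1 + n * g 1 1 := by
  simp [gmat, Matrix.mul_apply, Fin.sum_univ_two]

lemma Adm.gmat_step {a b c d n : ℤ} (h : Adm a b c d) (hn : 1 ≤ n) :
    Adm c d (a + n * c) (b + n * d) := by
  have hc := h.one_le_c
  have hd := h.one_le_d
  have h1 := h.a_nonneg
  have h2 := h.a_le_b
  have h3 := h.a_le_c
  have h4 := h.b_le_d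
  have h5 := h.c_le_d
  refine ⟨?_, by omega, h5, by nlinarith, by nlinarith, by nlinarith⟩
  rcases h.det with h | h
  · right; linarith
  · left; linarith

lemma adm_gmat_mul {g : Matrix (Fin 2) (Fin 2) ℤ} (hg : g ∈ Mmon) {n : ℤ} (hn : 1 ≤ n) :
    Adm ((gmat n * g) 0 0) ((gmat n * g) 0 1) ((gmat n * g) 1 0) ((gmat n * g) 1 1) := by
  obtain ⟨h1, h2, h3, h4⟩ := gmat_mul_entries n g
  rw [h1, h2, h3, h4]
  by_cases hg1 : g = 1
  · subst hg1
    constructor <;> simp <;> omega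
  · exact (adm_of_mem hg hg1).gmat_step hn

lemma mem_Mmon_of_adm {g : Matrix (Fin 2) (Fin 2) ℤ}
    (h : Adm (g 0 0) (g 0 1) (g 1 0) (g 1 1)) : g ∈ Mmon :=
  Or.inr ⟨h.det, h.b_le_d, h.a_le_b, h.a_nonneg, h.c_le_d, h.a_le_c⟩

lemma ne_one_of_adm {g : Matrix (Fin 2) (Fin 2) ℤ}
    (h : Adm (g 0 0) (g 0 1) (g 1 0) (g 1 1)) : g ≠ 1 := by
  rintro rfl
  simpa using h.one_le_b

lemma wordMat_mem : ∀ (k : ℕ) (w : Word k), wordMat k w ∈ Mmon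
  | 0, _ => Or.inl rfl
  | k + 1, w => mem_Mmon_of_adm (adm_gmat_mul (wordMat_mem k w.2) (by omega))

lemma adm_wordMat_succ (k : ℕ) (w : Word (k + 1)) :
    Adm (wordMat (k + 1) w 0 0) (wordMat (k + 1) w 0 1) (wordMat (k + 1) w 1 0)
      (wordMat (k + 1) w 1 1) :=
  adm_gmat_mul (wordMat_mem k w.2) (by omega)

lemma wordMat_injective : ∀ k : ℕ, Function.Injective (wordMat k)
  | 0 => fun _ _ _ => rfl
  | k + 1 => by
    rintro ⟨m, w⟩ ⟨m', w'⟩ h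
    have h : gmat (m + 1) * wordMat k w = gmat (m' + 1) * wordMat k w' := h
    obtain ⟨e1, e2, e3, e4⟩ := gmat_mul_entries (m + 1) (wordMat k w)
    obtain ⟨f1, f2, f3, f4⟩ := gmat_mul_entries (m' + 1) (wordMat k w')
    rw [← h, e1] at f1
    rw [← h, e2] at f2
    rw [← h, e3] at f3
    rw [← h, e4] at f4
    have hm : (m : ℤ) = m' := by
      cases k with
      | zero =>
        have : ∀ w, wordMat 0 w = 1 := fun _ => rfl
        simp [this] at f4
        omega
      | succ k =>
        have hA := adm_wordMat_succ k w
        have hA' := adm_wordMat_succ k w'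
        have g1 := hA.one_le_b
        have g2 := hA.b_le_d
        have g3 := hA'.one_le_b
        have g4 := hA'.b_le_d
        rw [← f2] at f4 g4
        rcases lt_trichotomy (m : ℤ) m' with hlt | heq | hlt
        · nlinarith
        · exact heq
        · nlinarith
    rw [← hm, ← f1] at f3
    rw [← hm, ← f2] at f4
    have hw : wordMat k w = wordMat k w' := by
      ext i j
      fin_cases i <;> fin_cases j
      · exact add_right_cancel f3
      · exact add_right_cancel f4
      · exact f1
      · exact f2
    rw [wordMat_injective k hw, Int.natCast_inj.1 hm]

lemma add_div_goldenRatio (d : ℝ) : d + d / Real.goldenRatio = d * Real.goldenRatio := by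
  have hg := Real.goldenRatio_pos
  have hsq := Real.goldenRatio_sq
  generalize Real.goldenRatio = x at *
  field_simp
  rw [hsq, add_comm]

lemma goldenRatio_pow_le : ∀ (k : ℕ) (w : Word k), Real.goldenRatio ^ k ≤
    (wordMat k w 1 1 : ℝ) + wordMat k w 0 1 / Real.goldenRatio
  | 0, w => by
    have : wordMat 0 w = 1 := rfl
    simp [this]
  | k + 1, w => by
    have ih := goldenRatio_pow_le k w.2
    obtain ⟨e1, e2, e3, e4⟩ := gmat_mul_entries (w.1 + 1) (wordMat k w.2)
    have h : wordMat (k + 1) w = gmat (w.1 + 1) * wordMat k w.2 := rfl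
    have hg := Real.goldenRatio_pos
    have hd : (0 : ℝ) ≤ wordMat k w.2 1 1 := by
      by_cases h1 : wordMat k w.2 = 1
      · simp [h1]
      · have := (adm_of_mem (wordMat_mem k w.2) h1).one_le_d
        exact_mod_cast (by omega : 0 ≤ wordMat k w.2 1 1)
    rw [h, e2, e4, pow_succ]
    push_cast
    set d : ℝ := ((wordMat k w.2 1 1 : ℤ) : ℝ)
    set b : ℝ := ((wordMat k w.2 0 1 : ℤ) : ℝ)
    have e : b + d + d / Real.goldenRatio = (d + b / Real.goldenRatio) * Real.goldenRatio := by
      rw [add_mul, ← add_div_goldenRatio, div_mul_cancel₀ _ hg.ne']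
      ring
    have hmd : 0 ≤ (w.1 : ℝ) * d := by positivity
    calc _ ≤ (d + b / Real.goldenRatio) * Real.goldenRatio := by gcongr
      _ ≤ _ := by rw [← e]; linarith

lemma goldenRatio_pow_le_wordMat (k : ℕ) (w : Word (k + 1)) :
    Real.goldenRatio ^ k ≤ wordMat (k + 1) w 1 1 := by
  have h := goldenRatio_pow_le (k + 1) w
  have hbd : (wordMat (k + 1) w 0 1 : ℝ) ≤ wordMat (k + 1) w 1 1 := by
    exact_mod_cast (adm_wordMat_succ k w).b_le_d
  have hg := Real.goldenRatio_pos
  set d : ℝ := ((wordMat (k + 1) w 1 1 : ℤ) : ℝ)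
  set b : ℝ := ((wordMat (k + 1) w 0 1 : ℤ) : ℝ)
  have : d + b / Real.goldenRatio ≤ d * Real.goldenRatio := by
    calc _ ≤ d + d / Real.goldenRatio := by gcongr
      _ = _ := add_div_goldenRatio d
  rw [pow_succ] at h
  exact le_of_mul_le_mul_right (h.trans this) hg

lemma Hnorm_congr {φ ψ : ℂ → ℂ} (h : EqOn φ ψ (cutPlane 0 1)) : Hnorm φ = Hnorm ψ := by
  have hF : ∀ w : ℂ, ‖w‖ < 1 → Fdisc φ w = Fdisc ψ w := by
    intro w hw
    by_cases h0 : w = 0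
    · simp [Fdisc, h0]
    · rw [Fdisc_of_ne h0, Fdisc_of_ne h0, h (jouk_mem_cutPlane h0 hw)]
  unfold Hnorm
  refine iSup_congr fun r => ?_
  congr 3
  ext θ
  rw [hF]
  rw [norm_mul, norm_exp_ofReal_mul_I, mul_one, norm_real, Real.norm_eq_abs, abs_of_pos r.2.1]
  exact r.2.2

lemma neg_nat_mem_cutPlane (m : ℕ) : -((m : ℂ) + 1) ∈ cutPlane 0 1 := by
  rw [mem_cutPlane_iff]
  rintro ⟨-, h, -⟩
  simp at h
  have : (0 : ℝ) ≤ m := by positivity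
  linarith

lemma inv_sub_nat_mem_cutPlane {z : ℂ} (hz : z ∈ cutPlane 0 1) (m : ℕ) :
    z⁻¹ - ((m : ℂ) + 1) ∈ cutPlane 0 1 := by
  have h := (adm_gmat_mul (Or.inl rfl : (1 : Matrix (Fin 2) (Fin 2) ℤ) ∈ Mmon)
    (by omega : (1 : ℤ) ≤ m + 1)).moebius_mem hz
  have hz0 := ne_zero_of_mem_cutPlane hz
  convert h using 1
  simp [gmat]
  field_simp
  ring

lemma Tterm_congr {φ ψ : ℂ → ℂ} (h : EqOn φ ψ (cutPlane 0 1)) {z : ℂ} (hz : z ∈ cutPlane 0 1)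
    (m : ℕ) : Tterm φ m z = Tterm ψ m z := by
  have hm := neg_nat_mem_cutPlane m
  rw [Tterm, Tterm, h hm, h (inv_sub_nat_mem_cutPlane hz m),
    (h.eventuallyEq_of_mem (isOpen_cutPlane.mem_nhds hm)).deriv_eq]

lemma Adm.hasDerivAt_Lform {a b c d : ℤ} (h : Adm a b c d) {φ : ℂ → ℂ} (hφ : φ ∈ O1 0 1) {z : ℂ}
    (hz : z ∈ cutPlane 0 1) : HasDerivAt (Lform a b c d φ)
      (-c * (φ ((d * z - b) / (a - c * z)) - φ (-(d : ℂ) / c)) +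
        ((a * d - b * c : ℤ) : ℂ) / (a - c * z) * deriv φ ((d * z - b) / (a - c * z))) z := by
  have hden := h.denom_ne hz
  have hM := h.moebius_mem hz
  have hφ' := (hφ.1.differentiableAt (isOpen_cutPlane.mem_nhds hM)).hasDerivAt
  have h1 : HasDerivAt (fun z : ℂ => (a : ℂ) - c * z) (-c) z := by
    simpa using ((hasDerivAt_id z).const_mul (c : ℂ)).const_sub (a : ℂ)
  have h2 : HasDerivAt (fun z : ℂ => (d : ℂ) * z - b) d z := by
    simpa using ((hasDerivAt_id z).const_mul (d : ℂ)).sub_const (b : ℂ)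
  have h3 := (h1.mul ((hφ'.comp z (h2.div h1 hden)).sub_const (φ (-(d : ℂ) / c)))).sub_const
    (((a * d - b * c : ℤ) : ℂ) * (c : ℂ)⁻¹ * deriv φ (-(d : ℂ) / c))
  refine h3.congr_deriv ?_
  simp only [Function.comp]
  push_cast
  congr 1
  field_simp
  ring

lemma Tterm_Lop {g : Matrix (Fin 2) (Fin 2) ℤ} (hg : g ∈ Mmon) {φ : ℂ → ℂ} (hφ : φ ∈ O1 0 1)
    {z : ℂ} (hz : z ∈ cutPlane 0 1) (m : ℕ) :
    Tterm (Lop g φ) m z = Lop (gmat (m + 1) * g) φ z := by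
  have hA' := adm_gmat_mul hg (by omega : (1 : ℤ) ≤ m + 1)
  have hz0 := ne_zero_of_mem_cutPlane hz
  obtain ⟨e1, e2, e3, e4⟩ := gmat_mul_entries (m + 1) g
  rw [Lop_eq_Lform (ne_one_of_adm hA')]
  have hden := hA'.denom_ne hz
  have hc' := hA'.c_ne
  rw [e1, e2, e3, e4] at *
  by_cases h1 : g = 1
  · subst h1
    rw [Lop_one, Tterm, Lform]
    have ez : ((m + 1 : ℤ) * z - 1) / (-z) = z⁻¹ - ((m : ℂ) + 1) := by
      push_cast
      field_simp
      ring
    simp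
    push_cast at ez
    rw [ez]
    left
    ring_nf
  · have hA := adm_of_mem hg h1
    rw [Lop_eq_Lform h1]
    set a := g 0 0
    set b := g 0 1
    set c := g 1 0
    set d := g 1 1
    rw [Tterm, (hA.hasDerivAt_Lform hφ (neg_nat_mem_cutPlane m)).deriv]
    have hd1 := hA.denom_ne (neg_nat_mem_cutPlane m)
    have hd2 := hA.denom_ne (inv_sub_nat_mem_cutPlane hz m)
    push_cast at hden hc'
    have q1 : ((d : ℂ) * (z⁻¹ - (m + 1)) - b) / (a - c * (z⁻¹ - (m + 1))) =
        ((b + (m + 1) * d : ℂ) * z - d) / (c - (a + (m + 1) * c) * z) := by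
      rw [div_eq_div_iff hd2 hden]
      field_simp
      ring
    have q2 : ((d : ℂ) * -(m + 1) - b) / (a - c * -(m + 1)) =
        -(b + (m + 1) * d : ℂ) / (a + (m + 1) * c) := by
      rw [div_eq_div_iff hd1 hc']
      ring
    simp only [Lform]
    push_cast
    rw [q1, q2]
    have e5 : (a : ℂ) - c * -(m + 1) = a + (m + 1) * c := by ring
    rw [e5]
    generalize φ (((b + (m + 1) * d : ℂ) * z - d) / (c - (a + (m + 1) * c) * z)) = A
    generalize φ (-(b + (m + 1) * d : ℂ) / (a + (m + 1) * c)) = B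
    generalize φ (-(d : ℂ) / c) = D
    generalize deriv φ (-(b + (m + 1) * d : ℂ) / (a + (m + 1) * c)) = E
    field_simp
    ring

lemma Tterm_tsum {ι : Type*} {ψ : ι → ℂ → ℂ} (hψ : ∀ i, ψ i ∈ H1space) (hS : ∑' i, Hnorm (ψ i) < ⊤) {z : ℂ}
    (hz : z ∈ cutPlane 0 1) (m : ℕ) :
    Tterm (fun w => ∑' i, ψ i w) m z = ∑' i, Tterm (ψ i) m z := by
  have hm := neg_nat_mem_cutPlane m
  have h1 := (summable_norm_of_tsum_Hnorm hψ hS (inv_sub_nat_mem_cutPlane hz m)).of_norm.hasSum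
  have h2 := (summable_norm_of_tsum_Hnorm hψ hS hm).of_norm.hasSum
  exact ((((h1.sub h2).mul_left (-z)).add (hasSum_deriv_of_tsum_Hnorm hψ hS hm)).tsum_eq).symm

lemma tsum_wordMat_lt_top {φ : ℂ → ℂ} (hφ : φ ∈ H1space) (k : ℕ) :
    ∑' w : Word k, Hnorm (Lop (wordMat k w) φ) < ⊤ := by
  have hinj : Function.Injective fun w : Word k => (⟨wordMat k w, wordMat_mem k w⟩ : Mmon) :=
    fun w w' h => wordMat_injective k (congrArg Subtype.val h)
  exact (ENNReal.tsum_comp_le_tsum_of_injective hinj fun g : Mmon => Hnorm (Lop g.1 φ)).trans_lt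
    (tsum_Hnorm_Lop_lt_top hφ)

lemma iterate_Tbrj_eqOn {φ : ℂ → ℂ} (hφ : φ ∈ H1space) : ∀ k : ℕ,
    EqOn (Tbrj^[k] φ) (fun z => ∑' w : Word k, Lop (wordMat k w) φ z) (cutPlane 0 1)
  | 0 => fun z _ => by
    have : ∀ w, wordMat 0 w = 1 := fun _ => rfl
    simp only [this, Lop_one, Function.iterate_zero, id]
    change φ z = ∑' _ : Unit, φ z
    simp
  | k + 1 => fun z hz => by
    have ih := iterate_Tbrj_eqOn hφ k
    rw [Function.iterate_succ_apply']
    have hmem : ∀ k (w : Word k), Lop (wordMat k w) φ ∈ H1space := fun k w =>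
      Lop_mem_H1space (wordMat_mem k w) hφ
    have hs := (summable_norm_of_tsum_Hnorm (hmem (k + 1)) (tsum_wordMat_lt_top hφ (k + 1))
      hz).of_norm
    calc Tbrj (Tbrj^[k] φ) z = ∑' m : ℕ, ∑' w : Word k, Lop (wordMat (k + 1) (m, w)) φ z := by
          refine tsum_congr fun m => ?_
          rw [Tterm_congr ih hz, Tterm_tsum (hmem k) (tsum_wordMat_lt_top hφ k) hz]
          exact tsum_congr fun w => Tterm_Lop (wordMat_mem k w) hφ.1 hz m
      _ = _ := (Summable.tsum_prod (β := ℕ) (γ := Word k) hs).symm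

lemma exists_goldenRatio_rpow_le {ε : ℝ} (hε : 0 < ε) :
    ∃ η : ℝ, 0 < η ∧ η < 1 / 3 ∧
      Real.goldenRatio ^ (-(1 - 3 * η)) ≤ (Real.sqrt 5 - 1) / 2 + ε := by
  have hlim : ContinuousAt (fun η : ℝ => Real.goldenRatio ^ (-(1 - 3 * η))) 0 :=
    (Real.continuous_const_rpow Real.goldenRatio_pos.ne').comp (by fun_prop) |>.continuousAt
  have h0 : Real.goldenRatio ^ (-(1 - 3 * (0 : ℝ))) < (Real.sqrt 5 - 1) / 2 + ε := by
    have := Real.inv_goldenRatio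
    rw [mul_zero, sub_zero, Real.rpow_neg_one, this, Real.goldenConj]
    linarith
  have hev := (hlim.eventually_lt_const h0).filter_mono (nhdsWithin_le_nhds (s := Ioi 0))
  obtain ⟨η, h1, h2⟩ := (hev.and (Ioo_mem_nhdsGT (by norm_num : (0 : ℝ) < 1 / 3))).exists
  exact ⟨η, h2.1, h2.2, h1.le⟩

lemma exists_Hnorm_iterate_Tbrj_le {ε : ℝ} (hε : 0 < ε) : ∃ C > 0, ∀ (k : ℕ), ∀ φ ∈ H1space,
    Hnorm (Tbrj^[k] φ) ≤
      ENNReal.ofReal (C * ((Real.sqrt 5 - 1) / 2 + ε) ^ k) * Hnorm φ := by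
  obtain ⟨η, hη0, hη3, hρ⟩ := exists_goldenRatio_rpow_le hε
  obtain ⟨C, hC, hop⟩ := exists_Hnorm_Lop_le hη0 (by linarith)
  set R := (Real.sqrt 5 - 1) / 2 + ε with hR
  have hR0 : 0 < R := by
    have : (1 : ℝ) ≤ Real.sqrt 5 := Real.one_le_sqrt.2 (by norm_num)
    linarith
  set S := ∑' g : Mmon, ENNReal.ofReal (weight ((1 - η) / 2) (g.1 0 1) (g.1 1 1)) with hS
  have hSt : S < ⊤ := tsum_Mmon_weight_lt_top (by linarith)
  refine ⟨1 + C * S.toReal / R, by positivity, fun k φ hφ => ?_⟩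
  cases k with
  | zero =>
    have h1 : 1 ≤ ENNReal.ofReal ((1 + C * S.toReal / R) * R ^ 0) := by
      rw [pow_zero, mul_one, ENNReal.one_le_ofReal, le_add_iff_nonneg_right]
      positivity
    calc Hnorm φ = 1 * Hnorm φ := (one_mul _).symm
      _ ≤ _ := by gcongr
  | succ k =>
    have hinj : Function.Injective
        fun w : Word (k + 1) => (⟨wordMat (k + 1) w, wordMat_mem (k + 1) w⟩ : Mmon) :=
      fun w w' h => wordMat_injective (k + 1) (congrArg Subtype.val h)
    have hpow : ∀ w : Word (k + 1), opBound C η (wordMat (k + 1) w) ≤ ENNReal.ofReal (C * R ^ k) *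
        ENNReal.ofReal (weight ((1 - η) / 2) (wordMat (k + 1) w 0 1) (wordMat (k + 1) w 1 1)) := by
      intro w
      have hA := adm_wordMat_succ k w
      rw [opBound, if_neg (ne_one_of_adm hA), ← ENNReal.ofReal_mul (by positivity), mul_assoc]
      refine ENNReal.ofReal_le_ofReal (mul_le_mul_of_nonneg_left ?_ hC.le)
      refine (weight_le_mul hη3.le (pow_pos Real.goldenRatio_pos k)
        (goldenRatio_pow_le_wordMat k w)).trans ?_
      refine mul_le_mul_of_nonneg_right ?_ (weight_nonneg _ (by linarith [hA.one_le_d]))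
      rw [← Real.rpow_natCast, ← Real.rpow_mul Real.goldenRatio_pos.le, mul_comm,
        Real.rpow_mul Real.goldenRatio_pos.le, Real.rpow_natCast]
      exact pow_le_pow_left₀ (Real.rpow_nonneg Real.goldenRatio_pos.le _) hρ k
    rw [Hnorm_congr (iterate_Tbrj_eqOn hφ (k + 1))]
    calc _ ≤ ∑' w : Word (k + 1), Hnorm (Lop (wordMat (k + 1) w) φ) :=
          Hnorm_tsum_le (fun w => Lop_mem_H1space (wordMat_mem _ w) hφ)
            (tsum_wordMat_lt_top hφ (k + 1))
      _ ≤ ∑' w : Word (k + 1), ENNReal.ofReal (C * R ^ k) * ENNReal.ofReal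
            (weight ((1 - η) / 2) (wordMat (k + 1) w 0 1) (wordMat (k + 1) w 1 1)) * Hnorm φ :=
          ENNReal.tsum_le_tsum fun w => (hop _ (wordMat_mem _ w) φ hφ).trans
            (mul_le_mul_left (hpow w) _)
      _ ≤ ENNReal.ofReal (C * R ^ k) * S * Hnorm φ := by
          rw [ENNReal.tsum_mul_right, ENNReal.tsum_mul_left]
          gcongr
          exact ENNReal.tsum_comp_le_tsum_of_injective hinj fun g : Mmon =>
            ENNReal.ofReal (weight ((1 - η) / 2) (g.1 0 1) (g.1 1 1))
      _ = ENNReal.ofReal (C * R ^ k * S.toReal) * Hnorm φ := by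
          rw [ENNReal.ofReal_mul (q := S.toReal) (by positivity), ENNReal.ofReal_toReal hSt.ne]
      _ ≤ _ := by
          refine mul_le_mul_left (ENNReal.ofReal_le_ofReal ?_) _
          have : (1 + C * S.toReal / R) * R ^ (k + 1) = R ^ (k + 1) + C * R ^ k * S.toReal := by
            field_simp
            ring
          rw [this]
          have : 0 ≤ R ^ (k + 1) := by positivity
          linarith

/-- each `L_g` is bounded on `H¹`, `Σ_{g∈ℳ} ‖L_g‖` converges, `Σ_ℳ` is a
bounded operator on `H¹`, and `T` has spectral radius at most `(√5 − 1)/2` on `H¹`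
(Corollary 4.10). -/
theorem sumM_bounded_H1 :
    (∀ g ∈ Mmon, ∀ φ ∈ H1space, Lop g φ ∈ H1space) ∧
      (∀ g ∈ Mmon, Lnorm g < ⊤) ∧
      (∑' g : Mmon, Lnorm g.1) < ⊤ ∧
      (∀ φ ∈ H1space, sumM φ ∈ H1space) ∧
      (∃ C : ℝ≥0∞, C < ⊤ ∧ ∀ φ ∈ H1space, Hnorm (sumM φ) ≤ C * Hnorm φ) ∧
      ∀ ε : ℝ, 0 < ε → ∃ C > 0, ∀ (k : ℕ), ∀ φ ∈ H1space,
        Hnorm (Tbrj^[k] φ) ≤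
          ENNReal.ofReal (C * ((Real.sqrt 5 - 1) / 2 + ε) ^ k) * Hnorm φ := by
  obtain ⟨C, hC, hop⟩ := exists_Hnorm_Lop_le (η := 1 / 4) (by norm_num) (by norm_num)
  have hsum := tsum_opBound_lt_top hC.le (by norm_num : (1 / 4 : ℝ) < 1 / 2)
  have hL : ∀ g ∈ Mmon, Lnorm g ≤ opBound C (1 / 4) g := fun g hg =>
    iSup_le fun φ => (hop g hg φ.1 φ.2.1).trans (mul_le_of_le_one_right' φ.2.2)
  refine ⟨fun g hg φ hφ => Lop_mem_H1space hg hφ,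
    fun g hg => (hL g hg).trans_lt (opBound_lt_top _ _ _),
    (ENNReal.tsum_le_tsum fun g : Mmon => hL g.1 g.2).trans_lt hsum,
    fun φ hφ => tsum_mem_H1space (fun g : Mmon => Lop_mem_H1space g.2 hφ)
      (tsum_Hnorm_Lop_lt_top hφ),
    ⟨_, hsum, fun φ hφ => ?_⟩, fun ε hε => exists_Hnorm_iterate_Tbrj_le hε⟩
  refine (Hnorm_tsum_le (fun g : Mmon => Lop_mem_H1space g.2 hφ)
    (tsum_Hnorm_Lop_lt_top hφ)).trans ?_
  rw [← ENNReal.tsum_mul_right]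
  exact ENNReal.tsum_le_tsum fun g : Mmon => hop g.1 g.2 φ hφ

end
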